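/- arXiv:2009.04230 — 7 statements merged into one kernel-verified Lean document; each statement's English description precedes it below -/
import Mathlib

section
/- Let G be a finite group, θ : G → G an involutive automorphism, and H ⊆ G a θ-stable subgroup (θ(H) = H). Assume that for every x ∈ G there exists g ∈ G such that g x⁻¹ g⁻¹ = θ(x). Then the following are equivalent: (1) (G,H) is a Gelfand pair; (2) for every x ∈ G there exist h₁, h₂ ∈ H such that h₁ x⁻¹ h₂ = θ(x). -/
open scoped Classical TensorProduct

noncomputable section

namespace GK

variable {G : Type} [Group G]

/-- A complex representation is irreducible if it is nonzero and has no invariant subspaces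
other than `⊥` and `⊤`. -/
def IsIrred {V : Type} [AddCommGroup V] [Module ℂ V] (π : Representation ℂ G V) : Prop :=
  (⊥ : Submodule ℂ V) ≠ ⊤ ∧
    ∀ W : Submodule ℂ V, (∀ (g : G), ∀ v ∈ W, π g v ∈ W) → W = ⊥ ∨ W = ⊤

/-- The subspace `π^H` of vectors invariant under a subgroup `H`. -/
def invariantsOf {V : Type} [AddCommGroup V] [Module ℂ V] (π : Representation ℂ G V)
    (H : Subgroup G) : Submodule ℂ V where
  carrier := {v | ∀ h ∈ H, π h v = v}
  add_mem' := by
    intro a b ha hb h hh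
    simp [map_add, ha h hh, hb h hh]
  zero_mem' := by
    intro h hh
    simp
  smul_mem' := by
    intro c v hv h hh
    simp [map_smul, hv h hh]

/-- `(G, H)` is a Gelfand pair: every irreducible complex representation of `G` has at most
one-dimensional space of `H`-invariant vectors. -/
def IsGelfandPair (G : Type) [Group G] (H : Subgroup G) : Prop :=
  ∀ (V : Type) [AddCommGroup V] [Module ℂ V] [FiniteDimensional ℂ V]
    (π : Representation ℂ G V), IsIrred π →
      Module.finrank ℂ (invariantsOf π H) ≤ 1

/-- Isomorphism of representations. -/
def RepIso {V W : Type} [AddCommGroup V] [Module ℂ V] [AddCommGroup W] [Module ℂ W]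
    (π : Representation ℂ G V) (τ : Representation ℂ G W) : Prop :=
  ∃ e : V ≃ₗ[ℂ] W, ∀ (g : G) (v : V), e (π g v) = τ g (e v)

/-- `π ∘ θ ≅ π*`: the θ-twist of `π` is isomorphic to the dual (contragredient)
representation of `π`. -/
def ConjThetaIsoDual {V : Type} [AddCommGroup V] [Module ℂ V] (θ : G ≃* G)
    (π : Representation ℂ G V) : Prop :=
  RepIso (MonoidHom.comp π θ.toMonoidHom) π.dual

/-- `π` possesses a nonzero symmetric bilinear form `B` with
`B(π(g)v, w) = B(v, π(θ(g⁻¹))w)`. -/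
def HasSymForm {V : Type} [AddCommGroup V] [Module ℂ V] (θ : G ≃* G)
    (π : Representation ℂ G V) : Prop :=
  ∃ B : V →ₗ[ℂ] V →ₗ[ℂ] ℂ, B ≠ 0 ∧ (∀ v w, B v w = B w v) ∧
    ∀ (g : G) (v w : V), B (π g v) w = B v (π (θ g⁻¹) w)

/-- `π` possesses a nonzero antisymmetric bilinear form `B` with
`B(π(g)v, w) = B(v, π(θ(g⁻¹))w)`. -/
def HasAltForm {V : Type} [AddCommGroup V] [Module ℂ V] (θ : G ≃* G)
    (π : Representation ℂ G V) : Prop :=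
  ∃ B : V →ₗ[ℂ] V →ₗ[ℂ] ℂ, B ≠ 0 ∧ (∀ v w, B v w = - B w v) ∧
    ∀ (g : G) (v w : V), B (π g v) w = B v (π (θ g⁻¹) w)

/-- The twisted Frobenius–Schur indicator `ε_θ(π)`: `1` if `π` has a nonzero symmetric
θ-twisted invariant bilinear form, `-1` if it has a nonzero antisymmetric one, and `0`
otherwise (for irreducible `π` this last case is exactly `π ∘ θ ≇ π*`). -/
def eps {V : Type} [AddCommGroup V] [Module ℂ V] (θ : G ≃* G)
    (π : Representation ℂ G V) : ℤ :=
  if HasSymForm θ π then 1 else if HasAltForm θ π then -1 else 0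

end GK

namespace GK

section GelfandTrick

variable {G : Type} [Group G] {V : Type} [AddCommGroup V] [Module ℂ V]

/-- A submodule containing the orbit of a nonzero vector of an irreducible representation is
everything. -/
lemma IsIrred.eq_top_of_orbit_mem {π : Representation ℂ G V} (hπ : IsIrred π) {v : V}
    (hv : v ≠ 0) (U : Submodule ℂ V) (hU : ∀ g, π g v ∈ U) : U = ⊤ := by
  have hle : Submodule.span ℂ (Set.range fun g => π g v) ≤ U := by
    rw [Submodule.span_le]
    rintro _ ⟨g, rfl⟩
    exact hU g
  rcases hπ.2 (Submodule.span ℂ (Set.range fun g => π g v)) (by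
    intro g u hu
    induction hu using Submodule.span_induction with
    | mem x hx =>
      obtain ⟨k, rfl⟩ := hx
      exact Submodule.subset_span ⟨g * k, by simp⟩
    | zero => simp
    | add x y _ _ hx hy => rw [map_add]; exact Submodule.add_mem _ hx hy
    | smul c x _ hx => rw [map_smul]; exact Submodule.smul_mem _ c hx) with h | h
  · refine absurd ?_ hv
    have : v ∈ Submodule.span ℂ (Set.range fun g => π g v) :=
      Submodule.subset_span ⟨1, by simp⟩
    simpa [h] using this
  · exact top_le_iff.mp (h ▸ hle)

variable (π : Representation ℂ G V) {H : Subgroup G} {θ : G ≃* G}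

lemma apply_mem_of_map_eq (hH : H.map θ.toMonoidHom = H) {h : G} (hh : h ∈ H) : θ h ∈ H := by
  rw [← hH]
  exact ⟨h, hh, rfl⟩

lemma trace_twist_eq (hconj : ∀ x : G, ∃ g : G, g * x⁻¹ * g⁻¹ = θ x) (x : G) :
    LinearMap.trace ℂ V (π (θ x⁻¹)) = LinearMap.trace ℂ V (π x) := by
  obtain ⟨g, hg⟩ := hconj x⁻¹
  rw [← hg, inv_inv, map_mul, LinearMap.trace_mul_comm, ← map_mul]
  simp

variable [Fintype G]

/-- The unnormalized averaging operator `∑ h ∈ H, π h`. -/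
def sumOp (π : Representation ℂ G V) (H : Subgroup G) : Module.End ℂ V :=
  ∑ h : H, π (h : G)

variable (H)

lemma mul_sumOp {h : G} (hh : h ∈ H) : π h * sumOp π H = sumOp π H := by
  simp only [sumOp, Finset.mul_sum, ← map_mul]
  exact Fintype.sum_equiv (Equiv.mulLeft (⟨h, hh⟩ : H)) _ _ fun _ => rfl

lemma sumOp_mul {h : G} (hh : h ∈ H) : sumOp π H * π h = sumOp π H := by
  simp only [sumOp, Finset.sum_mul, ← map_mul]
  exact Fintype.sum_equiv (Equiv.mulRight (⟨h, hh⟩ : H)) _ _ fun _ => rfl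

lemma sumOp_apply_mem (v : V) : sumOp π H v ∈ invariantsOf π H := fun _ hh =>
  LinearMap.congr_fun (mul_sumOp π H hh) v

lemma sumOp_apply_of_mem {v : V} (hv : v ∈ invariantsOf π H) :
    sumOp π H v = (Fintype.card H : ℂ) • v := by
  have : ∀ h : H, π (h : G) v = v := fun h => hv h h.2
  simp [sumOp, LinearMap.sum_apply, this, Nat.cast_smul_eq_nsmul]

lemma sumOp_mul_eq_of_mem_double_coset {x y h k : G} (hh : h ∈ H) (hk : k ∈ H)
    (hxy : h * x * k = y) :
    sumOp π H * π y * sumOp π H = sumOp π H * π x * sumOp π H := by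
  rw [← hxy, map_mul, map_mul, ← mul_assoc, ← mul_assoc, sumOp_mul π H hh,
    mul_assoc _ (π k), mul_sumOp π H hk]

lemma sumOp_mul_mul_eq_sum (x y : G) :
    sumOp π H * π x * sumOp π H * π y * sumOp π H =
      ∑ h : H, sumOp π H * π (x * h * y) * sumOp π H := by
  conv_lhs => rw [mul_assoc (sumOp π H) (π x), mul_assoc (sumOp π H)]
  simp only [map_mul, ← Finset.mul_sum, ← Finset.sum_mul]
  rfl

variable {H}

/-- The involution `h ↦ θ h⁻¹` of a `θ`-stable subgroup. -/
def invTwist (hθ : ∀ g, θ (θ g) = g) (hH : H.map θ.toMonoidHom = H) : H ≃ H where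
  toFun h := ⟨θ (h : G)⁻¹, apply_mem_of_map_eq hH (H.inv_mem h.2)⟩
  invFun h := ⟨θ (h : G)⁻¹, apply_mem_of_map_eq hH (H.inv_mem h.2)⟩
  left_inv h := by ext; simp [hθ]
  right_inv h := by ext; simp [hθ]

lemma sumOp_comm (hθ : ∀ g, θ (θ g) = g) (hH : H.map θ.toMonoidHom = H)
    (hx : ∀ x : G, ∃ h₁ ∈ H, ∃ h₂ ∈ H, h₁ * x⁻¹ * h₂ = θ x) (x y : G) :
    sumOp π H * π x * sumOp π H * π y * sumOp π H =
      sumOp π H * π y * sumOp π H * π x * sumOp π H := by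
  have twist (z : G) :
      sumOp π H * π (θ z⁻¹) * sumOp π H = sumOp π H * π z * sumOp π H := by
    obtain ⟨h, hh, k, hk, e⟩ := hx z⁻¹
    exact sumOp_mul_eq_of_mem_double_coset π H hh hk (by simpa using e)
  have key : ∑ h : H, sumOp π H * π (x * h * y) * sumOp π H =
      ∑ h : H, sumOp π H * π (θ y⁻¹ * h * θ x⁻¹) * sumOp π H := by
    refine Fintype.sum_equiv (invTwist hθ hH) _ _ fun h => ?_
    rw [← twist (x * h * y)]
    simp [invTwist, mul_assoc]
  rw [sumOp_mul_mul_eq_sum, key, ← sumOp_mul_mul_eq_sum, twist y,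
    mul_assoc, mul_assoc, ← mul_assoc (sumOp π H) (π (θ x⁻¹)), ← mul_assoc (sumOp π H * π y)]
  obtain ⟨h, hh, k, hk, e⟩ := hx x⁻¹
  rw [inv_inv] at e
  rw [← e, map_mul, map_mul]
  simp only [mul_assoc, mul_sumOp π H hk]
  simp only [← mul_assoc]
  rw [mul_assoc (sumOp π H * π y), sumOp_mul π H hh]

lemma finrank_invariantsOf_le_one [FiniteDimensional ℂ V] (hπ : IsIrred π)
    (hcomm : ∀ x y : G, sumOp π H * π x * sumOp π H * π y * sumOp π H =
      sumOp π H * π y * sumOp π H * π x * sumOp π H) :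
    Module.finrank ℂ (invariantsOf π H) ≤ 1 := by
  have hcard : (Fintype.card H : ℂ) ≠ 0 := by simp
  rcases eq_or_ne (invariantsOf π H) ⊥ with hbot | hbot
  · simp [Submodule.finrank_eq_zero.mpr hbot]
  have : Nontrivial (invariantsOf π H) := Submodule.nontrivial_iff_ne_bot.mpr hbot
  have scalar (x : G) : ∃ c : ℂ, sumOp π H * π x * sumOp π H = c • sumOp π H := by
    let T : Module.End ℂ (invariantsOf π H) :=
      (sumOp π H * π x).restrict fun v _ => sumOp_apply_mem π H (π x v)
    obtain ⟨c, hc⟩ := Module.End.exists_eigenvalue T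
    obtain ⟨v, hv⟩ := hc.exists_hasEigenvector
    have hTv : sumOp π H (π x v) = c • (v : V) := congrArg Subtype.val hv.apply_eq_smul
    have hv0 : (v : V) ≠ 0 := fun h => hv.2 (Subtype.ext h)
    refine ⟨c, ?_⟩
    rw [← LinearMap.eqLocus_eq_top]
    refine hπ.eq_top_of_orbit_mem hv0 _ fun y => ?_
    have h := LinearMap.congr_fun (hcomm x y) (v : V)
    simp only [Module.End.mul_apply, sumOp_apply_of_mem π H v.2, map_smul, hTv] at h
    have h' := smul_right_injective V hcard h
    simpa [LinearMap.mem_eqLocus] using h'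
  obtain ⟨v, hv⟩ := exists_ne (0 : invariantsOf π H)
  have hv0 : (v : V) ≠ 0 := fun h => hv (Subtype.ext h)
  have htop : (Submodule.span ℂ {(v : V)}).comap (sumOp π H) = ⊤ := by
    refine hπ.eq_top_of_orbit_mem hv0 _ fun x => ?_
    obtain ⟨c, hc⟩ := scalar x
    have h := LinearMap.congr_fun hc (v : V)
    simp only [Module.End.mul_apply, LinearMap.smul_apply, sumOp_apply_of_mem π H v.2,
      map_smul] at h
    have h' := smul_right_injective V hcard (h.trans (smul_comm _ _ _))
    exact Submodule.mem_span_singleton.mpr ⟨c, h'.symm⟩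
  refine finrank_le_one v fun w => ?_
  have hw : (w : V) ∈ (Submodule.span ℂ {(v : V)}).comap (sumOp π H) := htop ▸ trivial
  rw [Submodule.mem_comap, sumOp_apply_of_mem π H w.2, Submodule.mem_span_singleton] at hw
  obtain ⟨c, hc⟩ := hw
  refine ⟨(Fintype.card H : ℂ)⁻¹ * c, Subtype.ext ?_⟩
  rw [Submodule.coe_smul, mul_smul, hc, inv_smul_smul₀ hcard]

lemma trace_mul_sumOp_twist_eq (hθ : ∀ g, θ (θ g) = g) (hH : H.map θ.toMonoidHom = H)
    (hconj : ∀ x : G, ∃ g : G, g * x⁻¹ * g⁻¹ = θ x) (x : G) :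
    LinearMap.trace ℂ V (π (θ x⁻¹) * sumOp π H) =
      LinearMap.trace ℂ V (π x * sumOp π H) := by
  rw [LinearMap.trace_mul_comm ℂ (π x)]
  simp only [sumOp, Finset.mul_sum, Finset.sum_mul, ← map_mul, map_sum]
  refine Fintype.sum_equiv (invTwist hθ hH) _ _ fun h => ?_
  rw [← trace_twist_eq π hconj]
  simp [invTwist, hθ]

lemma sumOp_mul_twist_eq [FiniteDimensional ℂ V] (hθ : ∀ g, θ (θ g) = g)
    (hH : H.map θ.toMonoidHom = H) (hconj : ∀ x : G, ∃ g : G, g * x⁻¹ * g⁻¹ = θ x)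
    (hfin : Module.finrank ℂ (invariantsOf π H) ≤ 1) (x : G) :
    sumOp π H * π (θ x⁻¹) * sumOp π H = sumOp π H * π x * sumOp π H := by
  obtain ⟨w, hw⟩ := finrank_le_one_iff.mp hfin
  rcases eq_or_ne (w : V) 0 with hw0 | hw0
  · have : sumOp π H = 0 := by
      ext v
      obtain ⟨c, hc⟩ := hw ⟨_, sumOp_apply_mem π H v⟩
      simpa [hw0] using (congrArg Subtype.val hc).symm
    simp [this]
  obtain ⟨g, hg⟩ := Module.Projective.exists_dual_eq_one ℂ hw0
  have hrank : sumOp π H = (g ∘ₗ sumOp π H).smulRight (w : V) := by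
    ext v
    obtain ⟨c, hc⟩ := hw ⟨_, sumOp_apply_mem π H v⟩
    have hc' : c • (w : V) = sumOp π H v := congrArg Subtype.val hc
    simp [← hc', hg]
  have htrace (y : G) : LinearMap.trace ℂ V (π y * sumOp π H) = g (sumOp π H (π y w)) := by
    have : π y * sumOp π H = (g ∘ₗ sumOp π H).smulRight (π y w) := by
      ext v
      have := congrArg (π y) (LinearMap.congr_fun hrank v)
      simpa using this
    rw [this, LinearMap.trace_smulRight]
    rfl
  have hscalar (y : G) : sumOp π H * π y * sumOp π H =
      LinearMap.trace ℂ V (π y * sumOp π H) • sumOp π H := by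
    ext v
    rw [htrace]
    have h₁ := LinearMap.congr_fun hrank v
    have h₂ := LinearMap.congr_fun hrank (π y w)
    simp only [LinearMap.smulRight_apply, LinearMap.comp_apply] at h₁ h₂
    simp only [Module.End.mul_apply, LinearMap.smul_apply]
    rw [h₁]
    simp only [map_smul]
    rw [smul_comm, ← h₂]
  rw [hscalar, hscalar, trace_mul_sumOp_twist_eq π hθ hH hconj]

end GelfandTrick

section GroupAlgebra

variable {G : Type} [Group G]

/-- A left ideal of the group algebra, as a representation. -/
def idealRep (m : Submodule (MonoidAlgebra ℂ G) (MonoidAlgebra ℂ G)) :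
    Representation ℂ G (m.restrictScalars ℂ) :=
  Representation.ofModule' (m.restrictScalars ℂ)

lemma coe_idealRep_apply (m : Submodule (MonoidAlgebra ℂ G) (MonoidAlgebra ℂ G)) (g : G)
    (v : m.restrictScalars ℂ) :
    (idealRep m g v : MonoidAlgebra ℂ G) = MonoidAlgebra.single g 1 * (v : MonoidAlgebra ℂ G) := rfl

lemma isIrred_idealRep (m : Submodule (MonoidAlgebra ℂ G) (MonoidAlgebra ℂ G))
    (hm : IsSimpleModule (MonoidAlgebra ℂ G) m) : IsIrred (idealRep m) := by
  refine ⟨fun h => ?_, fun W hW => ?_⟩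
  · have := hm.nontrivial
    obtain ⟨v, hv⟩ := exists_ne (0 : m)
    have hv' : v ∈ (⊤ : Submodule ℂ (m.restrictScalars ℂ)) := trivial
    exact hv ((Submodule.mem_bot ℂ).mp (h ▸ hv'))
  · let W' : Submodule (MonoidAlgebra ℂ G) m :=
      { W.toAddSubmonoid with
        smul_mem' := fun a v hv => by
          induction a using MonoidAlgebra.induction_linear with
          | zero => rw [zero_smul]; exact W.zero_mem
          | add a b ha hb => rw [add_smul]; exact W.add_mem ha hb
          | single g c =>
            have : MonoidAlgebra.single g c • v = c • (idealRep m g v : m) := by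
              ext1
              change MonoidAlgebra.single g c * (v : MonoidAlgebra ℂ G) =
                c • (MonoidAlgebra.single g 1 * (v : MonoidAlgebra ℂ G))
              rw [← smul_mul_assoc, MonoidAlgebra.smul_single, smul_eq_mul, mul_one]
            rw [this]
            exact W.smul_mem c (hW g v hv) }
    refine (eq_bot_or_eq_top W').imp (fun h => ?_) fun h => ?_
    · exact SetLike.ext fun v => SetLike.ext_iff.mp h v
    · exact SetLike.ext fun v => SetLike.ext_iff.mp h v

variable [Fintype G]

/-- The sum of the elements of `H` in the group algebra. -/
def algSum (H : Subgroup G) : MonoidAlgebra ℂ G := ∑ h : H, MonoidAlgebra.single (h : G) 1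

lemma coe_sumOp_idealRep (H : Subgroup G)
    (m : Submodule (MonoidAlgebra ℂ G) (MonoidAlgebra ℂ G)) (v : m.restrictScalars ℂ) :
    (sumOp (idealRep m) H v : MonoidAlgebra ℂ G) = algSum H * (v : MonoidAlgebra ℂ G) := by
  simp only [sumOp, algSum, LinearMap.sum_apply, Finset.sum_mul, ← coe_idealRep_apply]
  exact Submodule.coe_sum _ _ _

/-- Two elements of the group algebra which act identically on all simple left ideals agree. -/
lemma eq_of_mul_eq_on_simples {a b : MonoidAlgebra ℂ G}
    (h : ∀ m : Submodule (MonoidAlgebra ℂ G) (MonoidAlgebra ℂ G),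
      IsSimpleModule (MonoidAlgebra ℂ G) m → ∀ v ∈ m, a * v = b * v) : a = b := by
  have h1 : (1 : MonoidAlgebra ℂ G) ∈ (⊤ : Submodule (MonoidAlgebra ℂ G) _) := trivial
  rw [← IsSemisimpleModule.sSup_simples_eq_top (MonoidAlgebra ℂ G), sSup_eq_iSup'] at h1
  have := Submodule.iSup_induction (p := fun m : {m : Submodule (MonoidAlgebra ℂ G)
    (MonoidAlgebra ℂ G) | IsSimpleModule (MonoidAlgebra ℂ G) m} => m.1)
    (motive := fun v => a * v = b * v) h1 (fun m v hv => h m.1 m.2 v hv) (by simp)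
    (fun x y hx hy => by rw [mul_add, mul_add, hx, hy])
  simpa using this

/-- The coefficients of `(∑ H) x (∑ H)` count factorizations `h * x * k`. -/
lemma coeff_algSum_mul (H : Subgroup G) (x y : G) :
    (algSum H * MonoidAlgebra.single x 1 * algSum H).coeff y =
      ((Finset.univ.filter fun p : H × H => (p.1 : G) * x * p.2 = y).card : ℂ) := by
  rw [← Finset.sum_boole, Fintype.sum_prod_type_right]
  simp [algSum, Finset.sum_mul, Finset.mul_sum, MonoidAlgebra.coeff_sum,
    MonoidAlgebra.single_mul_single, Finsupp.single_apply, -Finset.sum_boole]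

lemma exists_double_coset_of_algSum_eq {H : Subgroup G} {x y : G}
    (h : algSum H * MonoidAlgebra.single y 1 * algSum H =
      algSum H * MonoidAlgebra.single x 1 * algSum H) : ∃ h ∈ H, ∃ k ∈ H, h * x * k = y := by
  have hy := congrArg (fun a => a.coeff y) h
  simp only [coeff_algSum_mul, Nat.cast_inj] at hy
  have hpos : 0 < (Finset.univ.filter fun p : H × H => (p.1 : G) * y * p.2 = y).card :=
    Finset.card_pos.mpr ⟨1, by simp⟩
  rw [hy, Finset.card_pos] at hpos
  obtain ⟨p, hp⟩ := hpos
  exact ⟨p.1, p.1.2, p.2, p.2.2, by simpa using hp⟩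

end GroupAlgebra

end GK

/-- Under the conjugation hypothesis, `(G,H)` is a Gelfand pair iff every
`x ∈ G` satisfies the Gelfand–Kazhdan double coset condition. -/
theorem gelfand_kazhdan_iff {G : Type} [Group G] [Fintype G]
    (θ : G ≃* G) (hθ : ∀ g : G, θ (θ g) = g)
    (H : Subgroup G) (hH : H.map θ.toMonoidHom = H)
    (hconj : ∀ x : G, ∃ g : G, g * x⁻¹ * g⁻¹ = θ x) :
    GK.IsGelfandPair G H ↔ ∀ x : G, ∃ h₁ ∈ H, ∃ h₂ ∈ H, h₁ * x⁻¹ * h₂ = θ x := by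
  constructor
  · intro hG x
    have heq : GK.algSum H * MonoidAlgebra.single (θ x⁻¹) 1 * GK.algSum H =
        GK.algSum H * MonoidAlgebra.single x 1 * GK.algSum H := by
      refine GK.eq_of_mul_eq_on_simples fun m hm v hv => ?_
      have h := LinearMap.congr_fun (GK.sumOp_mul_twist_eq (GK.idealRep m) hθ hH hconj
        (hG _ _ (GK.isIrred_idealRep m hm)) x) ⟨v, hv⟩
      have h' := congrArg Subtype.val h
      simp only [Module.End.mul_apply] at h'
      repeat rw [GK.coe_sumOp_idealRep, GK.coe_idealRep_apply, GK.coe_sumOp_idealRep] at h'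
      simpa only [← mul_assoc] using h'
    obtain ⟨h, hh, k, hk, e⟩ := GK.exists_double_coset_of_algSum_eq heq
    refine ⟨k⁻¹, H.inv_mem hk, h⁻¹, H.inv_mem hh, ?_⟩
    rw [← inv_inj, ← map_inv, ← e]
    simp [mul_assoc]
  · intro hx V _ _ _ π hπ
    exact GK.finrank_invariantsOf_le_one π hπ (GK.sumOp_comm π hθ hH hx)
end
end

section
/- Let G be a finite group, θ : G → G an involutive automorphism, and H ⊆ G a θ-stable subgroup (θ(H) = H). Assume that for every x ∈ G there exists g ∈ G such that g x⁻¹ g⁻¹ = θ(x). If (G,H) is a Gelfand pair, then for every x ∈ G there exist h₁, h₂ ∈ H such that h₁ x⁻¹ h₂ = θ(x). -/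
open scoped Classical TensorProduct

noncomputable section

namespace GK

open MonoidAlgebra MulOpposite

/-- The sum of the elements of a subgroup `H`, as an element of the group algebra. -/
def subgroupSum {G : Type} [Group G] [Fintype G] (H : Subgroup G) : MonoidAlgebra ℂ G :=
  ∑ h : H, single (h : G) 1

/-- The antiautomorphism of the group algebra that extends `g ↦ θ g⁻¹`. -/
def twistedInv {G : Type} [Group G] (θ : G ≃* G) :
    MonoidAlgebra ℂ G →ₐ[ℂ] (MonoidAlgebra ℂ G)ᵐᵒᵖ :=
  MonoidAlgebra.lift ℂ (MonoidAlgebra ℂ G)ᵐᵒᵖ G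
    { toFun := fun g => op (single (θ g⁻¹) 1)
      map_one' := by simp [MonoidAlgebra.one_def]
      map_mul' := fun g k => by simp [← op_mul, single_mul_single] }

theorem unop_twistedInv_single {G : Type} [Group G] (θ : G ≃* G) (g : G) (c : ℂ) :
    unop (twistedInv θ (single g c)) = single (θ g⁻¹) c := by
  simp [twistedInv]

theorem coeff_unop_twistedInv {G : Type} [Group G] {θ : G ≃* G} (hθ : ∀ g : G, θ (θ g) = g)
    (f : MonoidAlgebra ℂ G) (y : G) :
    (unop (twistedInv θ f)).coeff y = f.coeff (θ y⁻¹) := by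
  induction f using MonoidAlgebra.induction_linear with
  | zero => simp
  | add f g hf hg => simp [hf, hg]
  | single g c =>
    have key : θ g⁻¹ = y ↔ g = θ y⁻¹ := by
      constructor
      · rintro rfl
        simp [hθ]
      · rintro rfl
        simp [hθ]
    rw [unop_twistedInv_single, coeff_single, coeff_single, Finsupp.single_apply,
      Finsupp.single_apply]
    simp only [key]

theorem coeff_conj_of_central {G : Type} [Group G] {z : MonoidAlgebra ℂ G}
    (hz : ∀ a, z * a = a * z) (g x : G) : z.coeff (g * x * g⁻¹) = z.coeff x := by
  have h := congrArg (fun f : MonoidAlgebra ℂ G => f.coeff (g * x)) (hz (single g 1))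
  simpa using h

theorem unop_twistedInv_of_central {G : Type} [Group G] {θ : G ≃* G}
    (hθ : ∀ g : G, θ (θ g) = g) (hconj : ∀ x : G, ∃ g : G, g * x⁻¹ * g⁻¹ = θ x)
    {z : MonoidAlgebra ℂ G} (hz : ∀ a, z * a = a * z) : unop (twistedInv θ z) = z := by
  ext y
  obtain ⟨g, hg⟩ := hconj y⁻¹
  rw [coeff_unop_twistedInv hθ, ← hg, inv_inv, coeff_conj_of_central hz]

theorem unop_twistedInv_subgroupSum {G : Type} [Group G] [Fintype G] {θ : G ≃* G}
    (hθ : ∀ g : G, θ (θ g) = g) {H : Subgroup G} (hH : H.map θ.toMonoidHom = H) :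
    unop (twistedInv θ (subgroupSum H)) = subgroupSum H := by
  have hmem : ∀ h ∈ H, θ h⁻¹ ∈ H := fun h hh => by
    rw [← hH]
    exact ⟨h⁻¹, H.inv_mem hh, rfl⟩
  rw [subgroupSum, map_sum, Finset.unop_sum]
  refine Finset.sum_nbij' (fun h => ⟨θ (h : G)⁻¹, hmem h h.2⟩)
    (fun h => ⟨θ (h : G)⁻¹, hmem h h.2⟩) ?_ ?_ ?_ ?_ ?_
  · simp
  · simp
  · simp [hθ]
  · simp [hθ]
  · simp [unop_twistedInv_single]

theorem single_mul_subgroupSum {G : Type} [Group G] [Fintype G] {H : Subgroup G} {h : G}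
    (hh : h ∈ H) : single h 1 * subgroupSum H = subgroupSum H := by
  rw [subgroupSum, Finset.mul_sum]
  refine Fintype.sum_equiv (Equiv.mulLeft ⟨h, hh⟩) _ _ fun k => ?_
  simp [single_mul_single]

/-- In a Gelfand pair, every matrix block of `e * a * e` is a scalar multiple of that of `e`,
where `e` is the sum of the elements of the subgroup. -/
theorem IsGelfandPair.exists_map_eq_smul {G : Type} [Group G] [Fintype G] {H : Subgroup G}
    (hGP : IsGelfandPair G H) {V : Type} [AddCommGroup V] [Module ℂ V] [FiniteDimensional ℂ V]
    [Nontrivial V] (f : MonoidAlgebra ℂ G →ₐ[ℂ] Module.End ℂ V) (hf : Function.Surjective f)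
    (a : MonoidAlgebra ℂ G) :
    ∃ c : ℂ, f (subgroupSum H * a * subgroupSum H) = c • f (subgroupSum H) := by
  let π : Representation ℂ G V := (f : MonoidAlgebra ℂ G →* Module.End ℂ V).comp (of ℂ G)
  have hπ : ∀ g, π g = f (single g 1) := fun g => rfl
  have hirr : IsIrred π := by
    refine ⟨bot_ne_top, fun W hW => or_iff_not_imp_left.2 fun hne => ?_⟩
    have hWf : ∀ b : MonoidAlgebra ℂ G, ∀ v ∈ W, f b v ∈ W := by
      intro b v hv
      rw [MonoidAlgebra.lift_unique f b, Finsupp.sum, LinearMap.sum_apply]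
      exact W.sum_mem fun g _ => W.smul_mem _ (hW g v hv)
    obtain ⟨w, hw, hw0⟩ := W.ne_bot_iff.1 hne
    refine eq_top_iff.2 fun v _ => ?_
    obtain ⟨l, hl⟩ : ∃ l : Module.Dual ℂ V, l w ≠ 0 := by
      simpa using mt (Module.forall_dual_apply_eq_zero_iff ℂ w).1 hw0
    obtain ⟨b, hb⟩ := hf (l.smulRight ((l w)⁻¹ • v))
    simpa [hb, hl] using hWf b w hw
  have hinv : ∀ v, f (subgroupSum H) v ∈ invariantsOf π H := fun v h hh => by
    rw [hπ, ← Module.End.mul_apply, ← map_mul, single_mul_subgroupSum hh]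
  obtain ⟨v₀, hv₀⟩ := finrank_le_one_iff.1 (hGP V π hirr)
  obtain ⟨c, hc⟩ := hv₀ ⟨_, hinv (f a v₀)⟩
  have hc' : c • (v₀ : V) = f (subgroupSum H) (f a v₀) := congrArg Subtype.val hc
  refine ⟨c, LinearMap.ext fun w => ?_⟩
  obtain ⟨l, hl⟩ := hv₀ ⟨_, hinv w⟩
  have hl' : l • (v₀ : V) = f (subgroupSum H) w := congrArg Subtype.val hl
  simp only [map_mul, Module.End.mul_apply, LinearMap.smul_apply]
  rw [← hl', map_smul, map_smul, ← hc', smul_comm]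

/-- In a Gelfand pair, every element of the Hecke algebra is a central multiple of its unit, up to
normalization. -/
theorem IsGelfandPair.exists_central {G : Type} [Group G] [Fintype G] {H : Subgroup G}
    (hGP : IsGelfandPair G H) (a : MonoidAlgebra ℂ G) :
    ∃ z : MonoidAlgebra ℂ G, (∀ b, z * b = b * z) ∧
      subgroupSum H * a * subgroupSum H = z * subgroupSum H := by
  obtain ⟨n, d, hd, ⟨φ⟩⟩ :=
    IsSemisimpleRing.exists_algEquiv_pi_matrix_of_isAlgClosed ℂ (MonoidAlgebra ℂ G)
  have hblock : ∀ i, ∃ c : ℂ,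
      φ (subgroupSum H * a * subgroupSum H) i = c • φ (subgroupSum H) i := by
    intro i
    let f : MonoidAlgebra ℂ G →ₐ[ℂ] Module.End ℂ (Fin (d i) → ℂ) :=
      (Matrix.toLinAlgEquiv' : _ ≃ₐ[ℂ] _).toAlgHom.comp
        ((Pi.evalAlgHom ℂ (fun i => Matrix (Fin (d i)) (Fin (d i)) ℂ) i).comp φ.toAlgHom)
    have hf : Function.Surjective f :=
      Matrix.toLinAlgEquiv'.surjective.comp ((Function.surjective_eval i).comp φ.surjective)
    obtain ⟨c, hc⟩ := hGP.exists_map_eq_smul f hf a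
    refine ⟨c, Matrix.toLinAlgEquiv'.injective ?_⟩
    rw [map_smul]
    exact hc
  choose c hc using hblock
  have hz : φ (φ.symm fun i => c i • 1) = fun i => c i • 1 := φ.apply_symm_apply _
  refine ⟨φ.symm fun i => c i • 1, fun b => φ.injective ?_, φ.injective ?_⟩
  · rw [map_mul, map_mul, hz]
    ext1 i
    simp
  · rw [map_mul _ (φ.symm _), hz]
    ext1 i
    simp [hc i]

theorem coeff_subgroupSum_mul_single_mul {G : Type} [Group G] [Fintype G] (H : Subgroup G)
    (x y : G) : (subgroupSum H * single x 1 * subgroupSum H).coeff y =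
      (Finset.card {p : H × H | (p.1 : G) * x * p.2 = y} : ℂ) := by
  simp only [subgroupSum, Finset.sum_mul, Finset.mul_sum, single_mul_single, mul_one]
  rw [Finset.sum_comm, ← Fintype.sum_prod_type']
  simp [Finsupp.single_apply]

end GK

/-- Under the conjugation hypothesis, if `(G,H)` is a Gelfand pair then the
Gelfand–Kazhdan double coset condition holds. -/
theorem gelfand_kazhdan_of_gelfand {G : Type} [Group G] [Fintype G]
    (θ : G ≃* G) (hθ : ∀ g : G, θ (θ g) = g)
    (H : Subgroup G) (hH : H.map θ.toMonoidHom = H)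
    (hconj : ∀ x : G, ∃ g : G, g * x⁻¹ * g⁻¹ = θ x)
    (hGP : GK.IsGelfandPair G H) :
    ∀ x : G, ∃ h₁ ∈ H, ∃ h₂ ∈ H, h₁ * x⁻¹ * h₂ = θ x := by
  intro x
  obtain ⟨z, hz, hzx⟩ := hGP.exists_central (MonoidAlgebra.single x 1)
  have key := congrArg (fun f => MulOpposite.unop (GK.twistedInv θ f)) hzx
  simp only [map_mul, MulOpposite.unop_mul, GK.unop_twistedInv_subgroupSum hθ hH,
    GK.unop_twistedInv_of_central hθ hconj hz, GK.unop_twistedInv_single] at key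
  rw [← mul_assoc, ← hz, ← hzx] at key
  have hcoeff := congrArg (fun f : MonoidAlgebra ℂ G => f.coeff (θ x⁻¹)) key
  simp only [GK.coeff_subgroupSum_mul_single_mul, Nat.cast_inj] at hcoeff
  have hpos : 0 < Finset.card {p : H × H | (p.1 : G) * θ x⁻¹ * p.2 = θ x⁻¹} :=
    Finset.card_pos.2 ⟨1, by simp⟩
  obtain ⟨p, hp⟩ := Finset.card_pos.1 (hcoeff ▸ hpos)
  have hp' : (p.1 : G) * x * p.2 = θ x⁻¹ := by simpa using hp
  refine ⟨(p.2 : G)⁻¹, H.inv_mem p.2.2, (p.1 : G)⁻¹, H.inv_mem p.1.2, ?_⟩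
  rw [← inv_inv (θ x), ← map_inv, ← hp']
  group
end
end

section
/- Let G be a finite group, θ : G → G an involutive automorphism, and H ⊆ G a θ-stable subgroup (θ(H) = H). Then the following are equivalent: (1) (G,H) is a Gelfand pair and every H-distinguished irreducible complex representation π of G satisfies π ∘ θ ≅ π*; (2) for every g ∈ G there exist h₁, h₂ ∈ H such that h₁ g⁻¹ h₂ = θ(g). -/
open scoped Classical TensorProduct

noncomputable section

namespace GK

section

variable {G : Type} [Group G] {V : Type} [AddCommGroup V] [Module ℂ V]

/-- The operator `∑ h ∈ H, π h`, a multiple of the projection onto the `H`-invariants. -/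
def sumOver [Fintype G] (π : Representation ℂ G V) (H : Subgroup G) : V →ₗ[ℂ] V :=
  ∑ h : H, π h

theorem sumOver_apply [Fintype G] (π : Representation ℂ G V) (H : Subgroup G) (v : V) :
    sumOver π H v = ∑ h : H, π h v := by
  simp [sumOver]

theorem sumOver_mem_invariantsOf [Fintype G] (π : Representation ℂ G V) (H : Subgroup G) (v : V) :
    sumOver π H v ∈ invariantsOf π H := by
  intro k hk
  rw [sumOver_apply, map_sum]
  refine Fintype.sum_equiv (Equiv.mulLeft (⟨k, hk⟩ : H)) _ _ fun h => ?_
  simp [map_mul]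

theorem sumOver_apply_rep [Fintype G] (π : Representation ℂ G V) (H : Subgroup G) (v : V)
    {k : G} (hk : k ∈ H) : sumOver π H (π k v) = sumOver π H v := by
  simp only [sumOver_apply]
  refine Fintype.sum_equiv (Equiv.mulRight (⟨k, hk⟩ : H)) _ _ fun h => ?_
  simp [map_mul]

theorem sumOver_of_mem [Fintype G] {π : Representation ℂ G V} {H : Subgroup G} {v : V}
    (hv : v ∈ invariantsOf π H) : sumOver π H v = (Fintype.card H : ℂ) • v := by
  rw [sumOver_apply, Finset.sum_congr rfl fun (h : H) _ => hv h h.2]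
  simp [Nat.cast_smul_eq_nsmul]

theorem apply_sumOver [Fintype G] {π : Representation ℂ G V} {H : Subgroup G} {l : V →ₗ[ℂ] ℂ}
    (hl : ∀ h ∈ H, ∀ x, l (π h x) = l x) (v : V) :
    l (sumOver π H v) = Fintype.card H * l v := by
  rw [sumOver_apply, map_sum, Finset.sum_congr rfl fun (h : H) _ => hl h h.2 v]
  simp

theorem card_subgroup_ne_zero [Fintype G] (H : Subgroup G) : (Fintype.card H : ℂ) ≠ 0 :=
  Nat.cast_ne_zero.2 Fintype.card_ne_zero

/-- A nonzero `H`-invariant vector is detected by some `H`-invariant functional. -/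
theorem exists_invariant_functional [Fintype G] {π : Representation ℂ G V} {H : Subgroup G}
    {v : V} (hv : v ∈ invariantsOf π H) (hv0 : v ≠ 0) :
    ∃ l : V →ₗ[ℂ] ℂ, (∀ h ∈ H, ∀ x, l (π h x) = l x) ∧ l v ≠ 0 := by
  obtain ⟨f, hf⟩ : ∃ f : Module.Dual ℂ V, f v ≠ 0 := by
    by_contra! h
    exact hv0 ((Module.forall_dual_apply_eq_zero_iff ℂ v).1 h)
  refine ⟨f ∘ₗ sumOver π H, fun h hh x => ?_, ?_⟩
  · simp [sumOver_apply_rep π H x hh]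
  · simp [sumOver_of_mem hv, hf]

/-- The orbit of a nonzero vector spans an irreducible representation. -/
theorem IsIrred.span_orbit {π : Representation ℂ G V} (hπ : IsIrred π) {v : V} (hv0 : v ≠ 0) :
    Submodule.span ℂ (Set.range fun g => π g v) = ⊤ := by
  refine (hπ.2 _ fun g x hx => ?_).resolve_left fun h => ?_
  · induction hx using Submodule.span_induction with
    | mem x hx =>
      obtain ⟨k, rfl⟩ := hx
      exact Submodule.subset_span ⟨g * k, by simp [map_mul]⟩
    | zero => simp
    | add x y _ _ hx hy => rw [map_add]; exact add_mem hx hy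
    | smul c x _ hx => rw [map_smul]; exact Submodule.smul_mem _ c hx
  · have : v ∈ Submodule.span ℂ (Set.range fun g => π g v) :=
      Submodule.subset_span ⟨1, by simp⟩
    rw [h] at this
    exact hv0 (by simpa using this)

/-- The matrix coefficients given by `H`-invariant vectors and functionals are invariant under
`g ↦ θ g⁻¹`. -/
theorem matrixCoeff_of_forall_exists {θ : G ≃* G} {H : Subgroup G}
    (hGK : ∀ g : G, ∃ h₁ ∈ H, ∃ h₂ ∈ H, h₁ * g⁻¹ * h₂ = θ g)
    {π : Representation ℂ G V} {v : V} (hv : v ∈ invariantsOf π H) {l : V →ₗ[ℂ] ℂ}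
    (hl : ∀ h ∈ H, ∀ x, l (π h x) = l x) (g : G) :
    l (π (θ g⁻¹) v) = l (π g v) := by
  obtain ⟨h₁, hh₁, h₂, hh₂, h⟩ := hGK g⁻¹
  rw [← h, inv_inv, map_mul, map_mul, Module.End.mul_apply, Module.End.mul_apply, hv h₂ hh₂,
    hl h₁ hh₁]

/-- In an irreducible representation, an `H`-invariant vector can be carried to an `H`-invariant
functional by an intertwiner to the `θ`-twisted dual. -/
theorem exists_intertwiner [Fintype G] {θ : G ≃* G} (hθ : ∀ g, θ (θ g) = g) {H : Subgroup G}
    (hGK : ∀ g : G, ∃ h₁ ∈ H, ∃ h₂ ∈ H, h₁ * g⁻¹ * h₂ = θ g)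
    {π : Representation ℂ G V} (hπ : IsIrred π) {v : V} (hv : v ∈ invariantsOf π H)
    (hv0 : v ≠ 0) {l : V →ₗ[ℂ] ℂ} (hl : ∀ h ∈ H, ∀ x, l (π h x) = l x) :
    ∃ e : V →ₗ[ℂ] Module.Dual ℂ V, e v = l ∧
      ∀ (g : G) (x y : V), e (π g x) y = e x (π (θ g⁻¹) y) := by
  let P : (G → ℂ) →ₗ[ℂ] V := Fintype.linearCombination ℂ fun g => π g v
  let Q : (G → ℂ) →ₗ[ℂ] Module.Dual ℂ V :=
    Fintype.linearCombination ℂ fun g => l ∘ₗ π (θ g⁻¹)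
  have hspan := hπ.span_orbit hv0
  have hP : LinearMap.range P = ⊤ := by
    rw [← hspan]
    exact Fintype.range_linearCombination ℂ _
  have hQP (a : G → ℂ) (b : G) : Q a (π b v) = l (π (θ b⁻¹) (P a)) := by
    simp only [P, Q, Fintype.linearCombination_apply, LinearMap.sum_apply, map_sum,
      LinearMap.smul_apply, map_smul]
    refine Finset.sum_congr rfl fun g _ => ?_
    congr 1
    have := matrixCoeff_of_forall_exists hGK hv hl (θ b⁻¹ * g)
    simpa [hθ, map_mul] using this
  have hker : ∀ a, P a = 0 → Q a = 0 := fun a ha => by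
    refine LinearMap.ext_on_range hspan fun b => ?_
    rw [hQP, ha]
    simp
  obtain ⟨s, hs⟩ := P.exists_rightInverse_of_surjective hP
  have he (a : G → ℂ) : Q (s (P a)) = Q a := by
    rw [← sub_eq_zero, ← map_sub]
    refine hker _ ?_
    rw [map_sub, sub_eq_zero]
    exact LinearMap.congr_fun hs (P a)
  have hgen (k : G) : Q (s (π k v)) = l ∘ₗ π (θ k⁻¹) := by
    have := he (Pi.single k 1)
    simpa [P, Q, Fintype.linearCombination_apply_single] using this
  refine ⟨Q ∘ₗ s, ?_, fun g x y => ?_⟩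
  · have := hgen 1
    ext y
    simpa using LinearMap.congr_fun this y
  · have hx : x ∈ Submodule.span ℂ (Set.range fun g => π g v) := hspan ▸ Submodule.mem_top
    induction hx using Submodule.span_induction with
    | mem x hx =>
      obtain ⟨k, rfl⟩ := hx
      have h1 := LinearMap.congr_fun (hgen (g * k)) y
      have h2 := LinearMap.congr_fun (hgen k) (π (θ g⁻¹) y)
      simp only [map_mul, mul_inv_rev, Module.End.mul_apply, LinearMap.comp_apply] at h1 h2 ⊢
      rw [h1, h2]
    | zero => simp
    | add x y _ _ hx hy => simp only [map_add, LinearMap.add_apply, hx, hy]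
    | smul c x _ hx => simp only [map_smul, LinearMap.smul_apply, hx]

/-- A nonzero intertwiner from an irreducible representation to its `θ`-twisted dual is
bijective. -/
theorem IsIrred.bijective_intertwiner [FiniteDimensional ℂ V] {θ : G ≃* G}
    {π : Representation ℂ G V} (hπ : IsIrred π) {e : V →ₗ[ℂ] Module.Dual ℂ V}
    (he : ∀ (g : G) (x y : V), e (π g x) y = e x (π (θ g⁻¹) y)) (he0 : e ≠ 0) :
    Function.Bijective e := by
  have hinj : Function.Injective e := by
    rw [← LinearMap.ker_eq_bot]
    refine (hπ.2 (LinearMap.ker e) fun g x hx => ?_).resolve_right fun h =>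
      he0 (LinearMap.ker_eq_top.1 h)
    rw [LinearMap.mem_ker] at hx ⊢
    ext y
    rw [he, hx]
    rfl
  exact ⟨hinj, (LinearMap.injective_iff_surjective_of_finrank_eq_finrank
    Subspace.dual_finrank_eq.symm).1 hinj⟩

/-- Schur's lemma. -/
theorem IsIrred.exists_eq_smul [FiniteDimensional ℂ V] {π : Representation ℂ G V}
    (hπ : IsIrred π) (T : V →ₗ[ℂ] V) (hT : ∀ g x, T (π g x) = π g (T x)) :
    ∃ c : ℂ, ∀ x, T x = c • x := by
  have : Nontrivial V := by
    rw [← Submodule.nontrivial_iff ℂ]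
    exact ⟨⊥, ⊤, hπ.1⟩
  obtain ⟨c, hc⟩ := Module.End.exists_eigenvalue T
  refine ⟨c, fun x => ?_⟩
  have htop : Module.End.eigenspace T c = ⊤ := by
    refine (hπ.2 _ fun g x hx => ?_).resolve_left hc
    rw [Module.End.mem_eigenspace_iff] at hx ⊢
    rw [hT, hx, map_smul]
  exact Module.End.mem_eigenspace_iff.1 (htop ▸ Submodule.mem_top)

theorem conjThetaIsoDual_of_forall_exists [Fintype G] [FiniteDimensional ℂ V] {θ : G ≃* G}
    (hθ : ∀ g, θ (θ g) = g) {H : Subgroup G}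
    (hGK : ∀ g : G, ∃ h₁ ∈ H, ∃ h₂ ∈ H, h₁ * g⁻¹ * h₂ = θ g)
    {π : Representation ℂ G V} (hπ : IsIrred π) (hH : invariantsOf π H ≠ ⊥) :
    ConjThetaIsoDual θ π := by
  obtain ⟨v, hv, hv0⟩ := Submodule.exists_mem_ne_zero_of_ne_bot hH
  obtain ⟨l, hl, hlv⟩ := exists_invariant_functional hv hv0
  obtain ⟨e, hev, he⟩ := exists_intertwiner hθ hGK hπ hv hv0 hl
  have he0 : e ≠ 0 := by
    rintro rfl
    exact hlv (by simp [← hev])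
  refine ⟨LinearEquiv.ofBijective e (hπ.bijective_intertwiner he he0), fun g x => ?_⟩
  ext y
  have := he (θ g) x y
  rw [← map_inv, hθ] at this
  exact this

theorem isGelfandPair_of_forall_exists [Fintype G] {θ : G ≃* G} (hθ : ∀ g, θ (θ g) = g)
    {H : Subgroup G} (hGK : ∀ g : G, ∃ h₁ ∈ H, ∃ h₂ ∈ H, h₁ * g⁻¹ * h₂ = θ g) :
    IsGelfandPair G H := by
  intro V _ _ _ π hπ
  by_cases hH : invariantsOf π H = ⊥
  · rw [hH, finrank_bot]
    exact zero_le_one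
  obtain ⟨v, hv, hv0⟩ := Submodule.exists_mem_ne_zero_of_ne_bot hH
  obtain ⟨l, hl, hlv⟩ := exists_invariant_functional hv hv0
  have hl0 : l ≠ 0 := by
    rintro rfl
    exact hlv rfl
  obtain ⟨e, hev, he⟩ := exists_intertwiner hθ hGK hπ hv hv0 hl
  have he0 : e ≠ 0 := by
    rintro rfl
    exact hl0 hev.symm
  let E := LinearEquiv.ofBijective e (hπ.bijective_intertwiner he he0)
  have hE (x : V) : E x = e x := rfl
  refine finrank_le_one ⟨v, hv⟩ fun w => ?_
  obtain ⟨w, hw⟩ := w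
  by_cases hw0 : w = 0
  · exact ⟨0, Subtype.ext (by simp [hw0])⟩
  obtain ⟨f, hfw, hf⟩ := exists_intertwiner hθ hGK hπ hw hw0 hl
  obtain ⟨c, hc⟩ := hπ.exists_eq_smul (E.symm.toLinearMap ∘ₗ f) fun g x => by
    apply E.injective
    simp only [LinearMap.comp_apply, LinearEquiv.coe_coe, LinearEquiv.apply_symm_apply]
    ext y
    rw [hf, hE, he, ← hE, LinearEquiv.apply_symm_apply]
  have hcw : v = c • w := by
    rw [← hc w]
    apply E.injective
    simp only [LinearMap.comp_apply, LinearEquiv.coe_coe, LinearEquiv.apply_symm_apply]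
    rw [hE, hev, hfw]
  have hc0 : c ≠ 0 := by
    rintro rfl
    exact hv0 (by simpa using hcw)
  exact ⟨c⁻¹, Subtype.ext (by simp [hcw, smul_smul, hc0])⟩

/-- For a representation with at most one `H`-invariant vector up to scaling and isomorphic
to its `θ`-twisted dual, the spherical matrix coefficients are invariant under `g ↦ θ g⁻¹`. -/
theorem matrixCoeff_eq_of_rank_le_one [Fintype G] [FiniteDimensional ℂ V] {θ : G ≃* G}
    (hθ : ∀ g, θ (θ g) = g) {H : Subgroup G} (hH : H.map θ.toMonoidHom = H)
    {π : Representation ℂ G V}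
    (hrank : Module.finrank ℂ (invariantsOf π H) ≤ 1)
    (hdual : invariantsOf π H ≠ ⊥ → ConjThetaIsoDual θ π)
    {v : V} (hv : v ∈ invariantsOf π H) {l : V →ₗ[ℂ] ℂ}
    (hl : ∀ h ∈ H, ∀ x, l (π h x) = l x) (g : G) :
    l (π (θ g⁻¹) v) = l (π g v) := by
  by_cases hv0 : v = 0
  · simp [hv0]
  have hne : invariantsOf π H ≠ ⊥ := fun h => hv0 (by simpa [h] using hv)
  obtain ⟨e, he⟩ := hdual hne
  have hline (w : V) (hw : w ∈ invariantsOf π H) : ∃ c : ℂ, c • v = w := by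
    have h0 : (⟨v, hv⟩ : invariantsOf π H) ≠ 0 := fun h => hv0 (congrArg Subtype.val h)
    obtain ⟨u, hu⟩ := finrank_le_one_iff.1 hrank
    obtain ⟨a, ha⟩ := hu ⟨v, hv⟩
    obtain ⟨b, hb⟩ := hu ⟨w, hw⟩
    have ha0 : a ≠ 0 := by
      rintro rfl
      exact h0 (by simpa using ha.symm)
    refine ⟨b * a⁻¹, ?_⟩
    have := congrArg Subtype.val hb
    rw [← inv_smul_smul₀ ha0 u, ha, smul_smul] at this
    exact this
  have hzero {m : V →ₗ[ℂ] ℂ} (hm : ∀ h ∈ H, ∀ x, m (π h x) = m x) (hmv : m v = 0) : m = 0 := by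
    ext x
    obtain ⟨c, hc⟩ := hline _ (sumOver_mem_invariantsOf π H x)
    have := apply_sumOver hm x
    rw [← hc, map_smul, hmv, smul_zero, eq_comm, mul_eq_zero] at this
    exact this.resolve_left (card_subgroup_ne_zero H)
  have he' (k : G) (x y : V) : e (π k x) y = e x (π (θ k⁻¹) y) := by
    have := LinearMap.congr_fun (he (θ k) x) y
    rw [MonoidHom.comp_apply] at this
    change e (π (θ (θ k)) x) y = e x (π (θ k)⁻¹ y) at this
    rwa [hθ, ← map_inv] at this
  have hθH {h : G} (hh : h ∈ H) : θ h ∈ H := by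
    rw [← hH]
    exact ⟨h, hh, rfl⟩
  have hev (h : G) (hh : h ∈ H) (x : V) : e v (π h x) = e v x := by
    have := he' (θ h⁻¹) v x
    rw [hv _ (hθH (inv_mem hh))] at this
    simpa [hθ] using this.symm
  have hevv : e v v ≠ 0 := fun h => hv0 (by
    have := hzero hev h
    simpa using this)
  have hev' (h : G) (hh : h ∈ H) (x : V) : e (π h x) v = e x v := by
    rw [he', hv _ (hθH (inv_mem hh))]
  have hprop : l = (l v / (2 * e v v)) • (e v + e.toLinearMap.flip v) := by
    rw [← sub_eq_zero]
    refine hzero (fun h hh x => ?_) ?_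
    · simp [hl h hh, hev h hh, hev' h hh]
    · simp only [LinearMap.sub_apply, LinearMap.smul_apply, LinearMap.add_apply,
        LinearMap.flip_apply, LinearEquiv.coe_coe, smul_eq_mul]
      field_simp
      ring
  have hsymm : e v (π (θ g⁻¹) v) + e (π (θ g⁻¹) v) v = e v (π g v) + e (π g v) v := by
    rw [he' g v v, he' (θ g⁻¹) v v, ← map_inv, hθ, inv_inv, add_comm]
  rw [hprop]
  simp only [LinearMap.smul_apply, LinearMap.add_apply, LinearMap.flip_apply,
    LinearEquiv.coe_coe, hsymm]

/-- If the spherical matrix coefficients of all irreducible representations are invariant under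
`g ↦ θ g⁻¹`, so are those of all finite-dimensional representations. -/
theorem matrixCoeff_eq_of_irred [Fintype G] {θ : G ≃* G} {H : Subgroup G}
    (hirr : ∀ (V : Type) [AddCommGroup V] [Module ℂ V] [FiniteDimensional ℂ V]
      (π : Representation ℂ G V), IsIrred π → ∀ v ∈ invariantsOf π H, ∀ l : V →ₗ[ℂ] ℂ,
        (∀ h ∈ H, ∀ x, l (π h x) = l x) → ∀ g, l (π (θ g⁻¹) v) = l (π g v))
    [FiniteDimensional ℂ V] (π : Representation ℂ G V) {v : V} (hv : v ∈ invariantsOf π H)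
    {l : V →ₗ[ℂ] ℂ} (hl : ∀ h ∈ H, ∀ x, l (π h x) = l x) (g : G) :
    l (π (θ g⁻¹) v) = l (π g v) := by
  induction hn : Module.finrank ℂ V using Nat.strong_induction_on generalizing V with
  | _ n ih =>
  subst hn
  by_cases hirrπ : IsIrred π
  · exact hirr V π hirrπ v hv l hl g
  by_cases htriv : (⊥ : Submodule ℂ V) = ⊤
  · have : v = 0 := by
      rw [← Submodule.mem_bot ℂ, htriv]
      exact Submodule.mem_top
    simp [this]
  obtain ⟨W, hW, hbot, htop⟩ : ∃ W : Submodule ℂ V,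
      (∀ (g : G), ∀ v ∈ W, π g v ∈ W) ∧ W ≠ ⊥ ∧ W ≠ ⊤ := by
    by_contra! h
    exact hirrπ ⟨htriv, fun W hW => or_iff_not_imp_left.2 (h W hW)⟩
  obtain ⟨U, hU⟩ := exists_isCompl (⟨W, fun g _ hx => hW g _ hx⟩ : Subrepresentation π)
  have hcompl : IsCompl W U.toSubmodule := by
    refine ⟨disjoint_iff.2 ?_, codisjoint_iff.2 ?_⟩
    · exact congrArg Subrepresentation.toSubmodule hU.inf_eq_bot
    · exact congrArg Subrepresentation.toSubmodule hU.sup_eq_top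
  have key (S : Subrepresentation π) (hS : S.toSubmodule ≠ ⊤) {x : V}
      (hxS : x ∈ S.toSubmodule) (hx : x ∈ invariantsOf π H) :
      l (π (θ g⁻¹) x) = l (π g x) :=
    ih _ (Submodule.finrank_lt hS) S.toRepresentation
      (v := ⟨x, hxS⟩) (fun h hh => Subtype.ext (hx h hh))
      (l := l ∘ₗ S.toSubmodule.subtype) (fun h hh y => hl h hh y) rfl
  have hUtop : U.toSubmodule ≠ ⊤ := fun h => hbot (by simpa [h] using hcompl.inf_eq_bot)
  obtain ⟨w, hw, u, hu, rfl⟩ := Submodule.mem_sup.1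
    (hcompl.sup_eq_top ▸ Submodule.mem_top : v ∈ W ⊔ U.toSubmodule)
  have hinv : w ∈ invariantsOf π H ∧ u ∈ invariantsOf π H := by
    have hdiff (h : G) (hh : h ∈ H) : π h w = w ∧ π h u = u := by
      have hsum : π h w - w = u - π h u := by
        rw [sub_eq_sub_iff_add_eq_add, ← map_add, hv h hh, add_comm]
      have h0 : π h w - w = 0 := Submodule.disjoint_def.1 hcompl.disjoint _
        (sub_mem (hW h w hw) hw)
        (hsum ▸ sub_mem hu (U.apply_mem_toSubmodule h hu))
      exact ⟨sub_eq_zero.1 h0, (sub_eq_zero.1 (hsum ▸ h0)).symm⟩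
    exact ⟨fun h hh => (hdiff h hh).1, fun h hh => (hdiff h hh).2⟩
  rw [map_add, map_add, map_add, map_add, key ⟨W, fun g _ hx => hW g _ hx⟩ htop hw hinv.1,
    key U hUtop hu hinv.2]

/-- The representation of `G` on functions on `G` by left translation. -/
def leftTranslation (G : Type) [Group G] : Representation ℂ G (G → ℂ) where
  toFun g := LinearMap.funLeft ℂ ℂ (g⁻¹ * ·)
  map_one' := by
    ext
    simp [LinearMap.funLeft]
  map_mul' g h := by
    ext
    simp [LinearMap.funLeft, mul_assoc]

theorem leftTranslation_apply (g : G) (f : G → ℂ) (x : G) :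
    leftTranslation G g f x = f (g⁻¹ * x) :=
  rfl

/-- The summation functional `f ↦ ∑ h ∈ H, f h`. -/
def sumFunctional [Fintype G] (H : Subgroup G) : (G → ℂ) →ₗ[ℂ] ℂ :=
  ∑ h : H, LinearMap.proj (h : G)

theorem sumFunctional_apply [Fintype G] (H : Subgroup G) (f : G → ℂ) :
    sumFunctional H f = ∑ h : H, f h := by
  simp [sumFunctional]

theorem sumFunctional_leftTranslation [Fintype G] (H : Subgroup G) {k : G} (hk : k ∈ H)
    (f : G → ℂ) : sumFunctional H (leftTranslation G k f) = sumFunctional H f := by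
  simp only [sumFunctional_apply, leftTranslation_apply]
  refine Fintype.sum_equiv (Equiv.mulLeft (⟨k, hk⟩⁻¹ : H)) _ _ fun h => ?_
  simp

/-- If all spherical matrix coefficients are invariant under `g ↦ θ g⁻¹`, then this map preserves
the double cosets of `H`. -/
theorem exists_of_matrixCoeff_eq [Fintype G] {θ : G ≃* G} {H : Subgroup G}
    (h : ∀ v ∈ invariantsOf (leftTranslation G) H, ∀ l : (G → ℂ) →ₗ[ℂ] ℂ,
      (∀ k ∈ H, ∀ x, l (leftTranslation G k x) = l x) →
        ∀ g, l (leftTranslation G (θ g⁻¹) v) = l (leftTranslation G g v)) (g : G) :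
    ∃ h₁ ∈ H, ∃ h₂ ∈ H, h₁ * g⁻¹ * h₂ = θ g := by
  let f : G → ℂ := fun x => if ∃ h₁ ∈ H, ∃ h₂ ∈ H, h₁ * g⁻¹ * h₂ = x then 1 else 0
  have hf : f ∈ invariantsOf (leftTranslation G) H := by
    intro k hk
    ext x
    rw [leftTranslation_apply]
    refine if_congr ⟨?_, ?_⟩ rfl rfl
    · rintro ⟨a, ha, b, hb, hab⟩
      exact ⟨k * a, mul_mem hk ha, b, hb, by rw [mul_assoc, mul_assoc, ← mul_assoc a, hab]; simp⟩
    · rintro ⟨a, ha, b, hb, rfl⟩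
      exact ⟨k⁻¹ * a, mul_mem (inv_mem hk) ha, b, hb, by simp only [mul_assoc]⟩
  have key := h f hf (sumFunctional H) (fun k hk => sumFunctional_leftTranslation H hk) g
  have hright : sumFunctional H (leftTranslation G g f) = Fintype.card H := by
    rw [sumFunctional_apply, Finset.sum_congr rfl (g := fun _ => 1)]
    · simp
    · intro k _
      exact if_pos ⟨1, one_mem H, k, k.2, by simp⟩
  rw [hright, sumFunctional_apply] at key
  obtain ⟨k, -, hk⟩ := Finset.exists_ne_zero_of_sum_ne_zero
    (key.trans_ne (card_subgroup_ne_zero H))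
  rw [leftTranslation_apply] at hk
  have hex : ∃ h₁ ∈ H, ∃ h₂ ∈ H, h₁ * g⁻¹ * h₂ = (θ g⁻¹)⁻¹ * k := by
    by_contra hne
    exact hk (if_neg hne)
  obtain ⟨a, ha, b, hb, hab⟩ := hex
  refine ⟨a, ha, b * (k : G)⁻¹, mul_mem hb (inv_mem k.2), ?_⟩
  rw [← mul_assoc, hab]
  simp

end

end GK

/-- `(G,H)` is a Gelfand pair with all `H`-distinguished irreducible
representations satisfying `π ∘ θ ≅ π*` iff the Gelfand–Kazhdan condition holds. -/
theorem gelfand_and_selfdual_iff {G : Type} [Group G] [Fintype G]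
    (θ : G ≃* G) (hθ : ∀ g : G, θ (θ g) = g)
    (H : Subgroup G) (hH : H.map θ.toMonoidHom = H) :
    (GK.IsGelfandPair G H ∧
      ∀ (V : Type) [AddCommGroup V] [Module ℂ V] [FiniteDimensional ℂ V]
        (π : Representation ℂ G V), GK.IsIrred π → GK.invariantsOf π H ≠ ⊥ →
          GK.ConjThetaIsoDual θ π) ↔
    ∀ g : G, ∃ h₁ ∈ H, ∃ h₂ ∈ H, h₁ * g⁻¹ * h₂ = θ g := by
  refine ⟨fun ⟨hG, hdual⟩ => ?_, fun hGK => ⟨GK.isGelfandPair_of_forall_exists hθ hGK,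
    fun V _ _ _ π hπ hne => GK.conjThetaIsoDual_of_forall_exists hθ hGK hπ hne⟩⟩
  refine GK.exists_of_matrixCoeff_eq fun v hv l hl g =>
    GK.matrixCoeff_eq_of_irred (fun V _ _ _ π hπ w hw m hm k => ?_) _ hv hl g
  exact GK.matrixCoeff_eq_of_rank_le_one hθ hH (hG V π hπ) (hdual V π hπ) hw hm k
end
end

section
/- Let G be a finite group, θ : G → G an involutive automorphism, and H ⊆ G a subgroup. If (G,H) is a Gelfand pair and every H-distinguished irreducible complex representation π of G possesses a nonzero symmetric bilinear form B satisfying B(π(g)v, w) = B(v, π(θ(g⁻¹))w) for all g ∈ G and all vectors v, w, then for every g ∈ G there exist h₁, h₂ ∈ H such that h₁ g⁻¹ θ(h₂) = θ(g). -/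
open scoped Classical TensorProduct

noncomputable section

namespace GK

variable {G : Type} [Group G]

theorem IsIrred.comp_mulEquiv {V : Type} [AddCommGroup V] [Module ℂ V]
    {π : Representation ℂ G V} (hπ : IsIrred π) (θ : G ≃* G) :
    IsIrred (MonoidHom.comp π θ.toMonoidHom : Representation ℂ G V) := by
  refine ⟨hπ.1, fun W hW => hπ.2 W fun g v hv => ?_⟩
  simpa using hW (θ.symm g) v hv

/-- A nonzero θ-twisted invariant symmetric form on an irreducible representation is
nondegenerate. -/
theorem IsIrred.eq_zero_of_form {V : Type} [AddCommGroup V] [Module ℂ V]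
    {π : Representation ℂ G V} (hπ : IsIrred π) {θ : G ≃* G} {B : V →ₗ[ℂ] V →ₗ[ℂ] ℂ}
    (hB : B ≠ 0) (hinv : ∀ (g : G) (v w : V), B (π g v) w = B v (π (θ g⁻¹) w))
    {v : V} (hv : ∀ w, B v w = 0) : v = 0 := by
  rcases hπ.2 (LinearMap.ker B) fun g u hu => by
    ext w
    rw [LinearMap.mem_ker] at hu
    simp [hinv, hu] with h | h
  · rw [← Submodule.mem_bot (R := ℂ), ← h, LinearMap.mem_ker]
    ext w
    exact hv w
  · exact absurd (LinearMap.ker_eq_top.mp h) hB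

theorem sum_mem_invariantsOf {V : Type} [AddCommGroup V] [Module ℂ V]
    (π : Representation ℂ G V) (H : Subgroup G) [Fintype H] (v : V) :
    ∑ h : H, π h v ∈ invariantsOf π H := by
  intro k hk
  rw [map_sum]
  refine Fintype.sum_equiv (Equiv.mulLeft (⟨k, hk⟩ : H)) _ _ fun h => ?_
  simp

/-- The θ-twisted double coset averages of `θ g` and `g⁻¹` act in the same way on every
irreducible representation. -/
theorem sum_double_coset_eq {θ : G ≃* G} (hθ : ∀ g : G, θ (θ g) = g)
    {H : Subgroup G} [Fintype H] (hGP : IsGelfandPair G H)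
    {V : Type} [AddCommGroup V] [Module ℂ V] [FiniteDimensional ℂ V]
    {π : Representation ℂ G V} (hπ : IsIrred π)
    (hsf : invariantsOf π H ≠ ⊥ → HasSymForm θ π) (g : G) (v : V) :
    ∑ h : H, π h (π (θ g) (∑ k : H, π (θ k) v)) =
      ∑ h : H, π h (π g⁻¹ (∑ k : H, π (θ k) v)) := by
  by_cases hbot : invariantsOf π H = ⊥
  · have hzero (u : V) : ∑ h : H, π h u = 0 := by
      simpa [hbot] using sum_mem_invariantsOf π H u
    rw [hzero, hzero]
  obtain ⟨B, hB, hsymm, hinv⟩ := hsf hbot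
  let τ : Representation ℂ G V := MonoidHom.comp π θ.toMonoidHom
  obtain ⟨v₀, hv₀⟩ := finrank_le_one_iff.mp (hGP V τ (hπ.comp_mulEquiv θ))
  have hspan (u : V) : ∃ c : ℂ, c • (v₀ : V) = ∑ k : H, π (θ k) u := by
    obtain ⟨c, hc⟩ := hv₀ ⟨_, sum_mem_invariantsOf τ H u⟩
    exact ⟨c, congrArg Subtype.val hc⟩
  have hadj (u w : V) : B (∑ h : H, π h u) w = B u (∑ k : H, π (θ k) w) := by
    simp only [map_sum, LinearMap.sum_apply]
    refine Fintype.sum_equiv (Equiv.inv H) _ _ fun h => ?_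
    simp [hinv]
  rw [← sub_eq_zero]
  refine hπ.eq_zero_of_form hB hinv fun w => ?_
  obtain ⟨c, hc⟩ := hspan v
  obtain ⟨d, hd⟩ := hspan w
  have hcoeff : B (π (θ g) v₀) v₀ = B (π g⁻¹ v₀) v₀ := by
    rw [hinv, ← map_inv, hθ, hsymm]
  rw [map_sub, LinearMap.sub_apply, hadj, hadj, ← hc, ← hd]
  simp [hcoeff]

theorem isIrred_ofModule' {M : Type} [AddCommGroup M] [Module ℂ M] [Module (MonoidAlgebra ℂ G) M]
    [IsScalarTower ℂ (MonoidAlgebra ℂ G) M] [IsSimpleModule (MonoidAlgebra ℂ G) M] :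
    IsIrred (Representation.ofModule' M : Representation ℂ G M) := by
  have : Nontrivial M := IsSimpleModule.nontrivial (MonoidAlgebra ℂ G) M
  refine ⟨bot_ne_top, fun W hW => ?_⟩
  let W' : Submodule (MonoidAlgebra ℂ G) M := MonoidAlgebra.submoduleOfSMulMem W
    fun g v hv => by simpa [Representation.ofModule'] using hW g v hv
  rcases eq_bot_or_eq_top W' with h | h
  · exact Or.inl (SetLike.coe_injective (congrArg (SetLike.coe (A := Submodule (MonoidAlgebra ℂ G) M)) h))
  · exact Or.inr (SetLike.coe_injective (congrArg (SetLike.coe (A := Submodule (MonoidAlgebra ℂ G) M)) h))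

/-- An element of the group algebra that annihilates every irreducible representation is
zero. -/
theorem eq_zero_of_forall_irred [Fintype G] {x : MonoidAlgebra ℂ G}
    (hx : ∀ (V : Type) [AddCommGroup V] [Module ℂ V] [FiniteDimensional ℂ V]
      (π : Representation ℂ G V), IsIrred π → ∀ v, π.asAlgebraHom x v = 0) : x = 0 := by
  have : NeZero (Nat.card G : ℂ) := ⟨by simp⟩
  suffices h : ∀ y : MonoidAlgebra ℂ G, x * y = 0 by simpa using h 1
  intro y
  have hy : y ∈ sSup {S : Submodule (MonoidAlgebra ℂ G) (MonoidAlgebra ℂ G) |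
      IsSimpleModule (MonoidAlgebra ℂ G) S} := by
    rw [IsSemisimpleModule.sSup_simples_eq_top]
    trivial
  rw [sSup_eq_iSup'] at hy
  refine Submodule.iSup_induction _ (motive := fun y => x * y = 0) hy (fun S s hs => ?_)
    (mul_zero x) fun y z hy hz => by rw [mul_add, hy, hz, add_zero]
  have : IsSimpleModule (MonoidAlgebra ℂ G) S.1 := S.2
  have : FiniteDimensional ℂ (MonoidAlgebra ℂ G) :=
    Module.Finite.equiv (MonoidAlgebra.coeffLinearEquiv ℂ).symm
  have : FiniteDimensional ℂ S.1 :=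
    FiniteDimensional.of_injective (S.1.subtype.restrictScalars ℂ) Subtype.val_injective
  have h := hx S.1 (Representation.ofModule' S.1) isIrred_ofModule' ⟨s, hs⟩
  simpa [Representation.ofModule', Representation.asAlgebraHom] using congrArg Subtype.val h

end GK

/-- If `(G,H)` is a Gelfand pair and every `H`-distinguished irreducible
representation has a nonzero symmetric θ-twisted invariant bilinear form, then the twisted
Gelfand–Kazhdan condition holds. -/
theorem GK_of_gelfand_and_symform {G : Type} [Group G] [Fintype G]
    (θ : G ≃* G) (hθ : ∀ g : G, θ (θ g) = g)
    (H : Subgroup G)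
    (hGP : GK.IsGelfandPair G H)
    (hsf : ∀ (V : Type) [AddCommGroup V] [Module ℂ V] [FiniteDimensional ℂ V]
        (π : Representation ℂ G V), GK.IsIrred π → GK.invariantsOf π H ≠ ⊥ →
          GK.HasSymForm θ π) :
    ∀ g : G, ∃ h₁ ∈ H, ∃ h₂ ∈ H, h₁ * g⁻¹ * θ h₂ = θ g := by
  intro g
  let s (a : G) : MonoidAlgebra ℂ G :=
    ∑ h : H, ∑ k : H, MonoidAlgebra.single ((h : G) * a * θ k) 1
  have hs : s (θ g) - s g⁻¹ = 0 := by
    refine GK.eq_zero_of_forall_irred fun V _ _ _ π hπ v => ?_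
    have h := GK.sum_double_coset_eq hθ hGP hπ (hsf V π hπ) g v
    simp only [map_sum] at h
    simpa [s, sub_eq_zero, LinearMap.sum_apply] using h
  have hcoeff (a : G) : (s a).coeff (θ g) =
      ((Finset.univ.filter fun p : H × H => (p.1 : G) * a * θ p.2 = θ g).card : ℂ) := by
    simp [s, ← Fintype.sum_prod_type', Finsupp.single_apply]
  by_contra! hne
  have h := hcoeff (θ g)
  rw [sub_eq_zero.mp hs, hcoeff, Nat.cast_inj, Finset.card_eq_zero.mpr, eq_comm,
    Finset.card_eq_zero, Finset.filter_eq_empty_iff] at h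
  · exact h (Finset.mem_univ 1) (by simp)
  · exact Finset.filter_eq_empty_iff.mpr fun p _ => hne _ p.1.2 _ p.2.2
end
end

section
/- Let G be a finite group, θ : G → G an involutive automorphism, and H ⊆ G a subgroup. Let V be the complex vector space of functions f : G → ℂ such that f(hg) = f(g) for all h ∈ H, f(g h') = f(g) for all h' ∈ θ(H), and f(θ(g⁻¹)) = −f(g) for all g ∈ G. Then dim V = (1/2) · Σ_{π : ε_θ(π)=0} dim(π^H) · dim(π^{θ(H)}) + Σ_{π : ε_θ(π)=1} (dim(π^H) choose 2) + Σ_{π : ε_θ(π)=−1} (dim(π^H) + 1 choose 2), where each sum runs over (isomorphism classes of) irreducible complex representations π of G with the indicated value of ε_θ(π). -/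
open scoped Classical TensorProduct

noncomputable section

/-- The space `V` of functions on `G` which are left `H`-invariant, right `θ(H)`-invariant
and anti-invariant under `σ(g) = θ(g⁻¹)`. -/
def funSpaceV {G : Type} [Group G] (θ : G ≃* G) (H : Subgroup G) : Submodule ℂ (G → ℂ) where
  carrier := {f | (∀ h ∈ H, ∀ g : G, f (h * g) = f g) ∧
    (∀ h' ∈ H.map θ.toMonoidHom, ∀ g : G, f (g * h') = f g) ∧
    ∀ g : G, f (θ g⁻¹) = - f g}
  add_mem' := by
    rintro a b ⟨ha1, ha2, ha3⟩ ⟨hb1, hb2, hb3⟩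
    refine ⟨fun h hh g => ?_, fun h' hh' g => ?_, fun g => ?_⟩
    · simp [ha1 h hh g, hb1 h hh g]
    · simp [ha2 h' hh' g, hb2 h' hh' g]
    · simp only [Pi.add_apply]
      rw [ha3 g, hb3 g]; ring
  zero_mem' := ⟨fun _ _ _ => rfl, fun _ _ _ => rfl, fun _ => by simp⟩
  smul_mem' := by
    rintro c f ⟨h1, h2, h3⟩
    refine ⟨fun h hh g => ?_, fun h' hh' g => ?_, fun g => ?_⟩
    · simp [h1 h hh g]
    · simp [h2 h' hh' g]
    · simp only [Pi.smul_apply, smul_eq_mul]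
      rw [h3 g]; ring

namespace GK

section FourierTransform

variable {G : Type} [Group G] {V W : Type} [AddCommGroup V] [Module ℂ V] [AddCommGroup W]
  [Module ℂ W]

/-- Schur's lemma: a nonzero intertwiner between irreducible representations is an isomorphism. -/
theorem repIso_of_intertwiner_ne_zero {π : Representation ℂ G V} {τ : Representation ℂ G W}
    (hπ : IsIrred π) (hτ : IsIrred τ) (φ : V →ₗ[ℂ] W) (hφ : ∀ g v, φ (π g v) = τ g (φ v))
    (h0 : φ ≠ 0) : RepIso π τ := by
  have hker : LinearMap.ker φ = ⊥ := by
    refine (hπ.2 (LinearMap.ker φ) fun g v hv => ?_).resolve_right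
      fun h => h0 (LinearMap.ker_eq_top.1 h)
    simp [hφ, LinearMap.mem_ker.1 hv]
  have hrange : LinearMap.range φ = ⊤ := by
    refine (hτ.2 (LinearMap.range φ) ?_).resolve_left fun h => h0 (LinearMap.range_eq_bot.1 h)
    rintro g _ ⟨v, rfl⟩
    exact ⟨π g v, hφ g v⟩
  exact ⟨LinearEquiv.ofBijective φ ⟨LinearMap.ker_eq_bot.1 hker, LinearMap.range_eq_top.1 hrange⟩,
    hφ⟩

/-- Schur's lemma: an endomorphism of an irreducible representation is a scalar. -/
theorem exists_eq_smul_id_of_commute [FiniteDimensional ℂ V] {π : Representation ℂ G V}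
    (hπ : IsIrred π) (φ : V →ₗ[ℂ] V) (hφ : ∀ g v, φ (π g v) = π g (φ v)) :
    ∃ c : ℂ, φ = c • LinearMap.id := by
  have : Nontrivial V := (Submodule.nontrivial_iff ℂ).1 ⟨⊥, ⊤, hπ.1⟩
  obtain ⟨c, hc⟩ := Module.End.exists_eigenvalue φ
  refine ⟨c, ?_⟩
  have h := (hπ.2 (Module.End.eigenspace φ c) fun g v hv => ?_).resolve_left hc
  · ext v
    have hv : v ∈ Module.End.eigenspace φ c := h ▸ Submodule.mem_top
    simpa using Module.End.mem_eigenspace_iff.1 hv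
  · rw [Module.End.mem_eigenspace_iff] at hv ⊢
    rw [hφ, hv, map_smul]

variable [Fintype G]

/-- The operator `∑ g, f g • π g` by which a function `f` on `G` acts on a representation `π`. -/
def opOf (π : Representation ℂ G V) : (G → ℂ) →ₗ[ℂ] V →ₗ[ℂ] V where
  toFun f := ∑ g, f g • π g
  map_add' f f' := by simp [add_smul, Finset.sum_add_distrib]
  map_smul' c f := by simp [Finset.smul_sum, mul_smul]

theorem opOf_apply (π : Representation ℂ G V) (f : G → ℂ) (v : V) :
    opOf π f v = ∑ g, f g • π g v := by
  simp [opOf]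

theorem opOf_eq_zero_of_repIso {π : Representation ℂ G V} {τ : Representation ℂ G W}
    (h : RepIso π τ) {f : G → ℂ} (hf : opOf τ f = 0) : opOf π f = 0 := by
  obtain ⟨e, he⟩ := h
  ext v
  apply e.injective
  have := LinearMap.congr_fun hf (e v)
  simp only [opOf_apply, map_sum, map_smul, he, LinearMap.zero_apply, map_zero] at this ⊢
  exact this

/-- Averaging a linear map over the group yields an intertwiner. -/
theorem sum_conj_intertwines (π : Representation ℂ G V) (τ : Representation ℂ G W)
    (X : V →ₗ[ℂ] W) (g : G) (v : V) :
    (∑ x, τ x ∘ₗ X ∘ₗ π x⁻¹) (π g v) = τ g ((∑ x, τ x ∘ₗ X ∘ₗ π x⁻¹) v) := by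
  simp only [LinearMap.sum_apply, LinearMap.comp_apply, map_sum]
  refine Fintype.sum_equiv (Equiv.mulLeft g⁻¹) _ _ fun x => ?_
  simp [← Module.End.mul_apply, ← map_mul]

/-- The matrix coefficient `g ↦ l (π g⁻¹ w)`. -/
def coeffInv (π : Representation ℂ G V) (l : V →ₗ[ℂ] ℂ) (w : V) (g : G) : ℂ := l (π g⁻¹ w)

theorem opOf_coeffInv_apply (π : Representation ℂ G V) (τ : Representation ℂ G W)
    (l : V →ₗ[ℂ] ℂ) (w : V) (v : W) :
    opOf τ (coeffInv π l w) v = (∑ x, τ x ∘ₗ l.smulRight v ∘ₗ π x⁻¹) w := by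
  simp [opOf_apply, coeffInv]

theorem opOf_coeffInv_of_not_repIso {π : Representation ℂ G V} {τ : Representation ℂ G W}
    (hπ : IsIrred π) (hτ : IsIrred τ) (h : ¬ RepIso π τ) (l : V →ₗ[ℂ] ℂ) (w : V) :
    opOf τ (coeffInv π l w) = 0 := by
  ext v
  rw [opOf_coeffInv_apply]
  by_contra h0
  refine h (repIso_of_intertwiner_ne_zero hπ hτ _ (sum_conj_intertwines π τ (l.smulRight v)) ?_)
  rintro h1
  simp [h1] at h0

theorem opOf_coeffInv_self [FiniteDimensional ℂ V] {π : Representation ℂ G V}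
    (hπ : IsIrred π) (l : V →ₗ[ℂ] ℂ) (w : V) :
    opOf π (coeffInv π l w) =
      ((Fintype.card G : ℂ) / Module.finrank ℂ V) • l.smulRight w := by
  have : Nontrivial V := (Submodule.nontrivial_iff ℂ).1 ⟨⊥, ⊤, hπ.1⟩
  have hd : (Module.finrank ℂ V : ℂ) ≠ 0 := by
    exact_mod_cast (Module.finrank_pos (R := ℂ) (M := V)).ne'
  ext v
  rw [opOf_coeffInv_apply]
  obtain ⟨c, hc⟩ := exists_eq_smul_id_of_commute hπ _ (sum_conj_intertwines π π (l.smulRight v))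
  have htr := congrArg (LinearMap.trace ℂ V) hc
  have hx : ∀ x, LinearMap.trace ℂ V (π x ∘ₗ l.smulRight v ∘ₗ π x⁻¹) = l v := fun x => by
    rw [LinearMap.trace_comp_comm', LinearMap.comp_assoc, ← Module.End.mul_eq_comp (π x⁻¹),
      ← map_mul]
    simp [Module.End.one_eq_id]
  simp only [map_sum, hx, Finset.sum_const, Finset.card_univ, map_smul, LinearMap.trace_id,
    nsmul_eq_mul, smul_eq_mul] at htr
  rw [hc]
  have hc' : c = Fintype.card G / Module.finrank ℂ V * l v := by
    field_simp
    exact htr.symm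
  simp [hc', smul_smul]

/-- A function acting by zero on all irreducible representations vanishes. -/
theorem eq_zero_of_opOf_eq_zero (f : G → ℂ)
    (hf : ∀ (W : Type) [AddCommGroup W] [Module ℂ W] [FiniteDimensional ℂ W]
      (τ : Representation ℂ G W), IsIrred τ → opOf τ f = 0) : f = 0 := by
  let a : MonoidAlgebra ℂ G := ∑ g, MonoidAlgebra.single g (f g)
  have : NeZero (Nat.card G : ℂ) := ⟨by simp⟩
  have hfin : FiniteDimensional ℂ (MonoidAlgebra ℂ G) :=
    Module.Finite.equiv (MonoidAlgebra.coeffLinearEquiv ℂ).symm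
  have ha : a ∈ (⊤ : Submodule (MonoidAlgebra ℂ G) (MonoidAlgebra ℂ G)).annihilator := by
    rw [← IsSemisimpleModule.sSup_simples_eq_top, sSup_eq_iSup', Submodule.annihilator_iSup,
      Submodule.mem_iInf]
    rintro ⟨S, hS⟩
    let τ : Representation ℂ G S := Representation.ofModule' S
    have hτ : ∀ g v, τ g v = MonoidAlgebra.single g (1 : ℂ) • v := fun g v => by
      simp [τ, Representation.ofModule']
    have : FiniteDimensional ℂ S :=
      inferInstanceAs (FiniteDimensional ℂ (S.restrictScalars ℂ))
    have hsingle : ∀ (g : G) (c : ℂ) (v : S), MonoidAlgebra.single g c • v = c • τ g v := by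
      intro g c v
      rw [hτ, ← smul_assoc, MonoidAlgebra.smul_single, smul_eq_mul, mul_one]
    have hirr : IsIrred τ := by
      have : IsSimpleModule (MonoidAlgebra ℂ G) S := hS
      have : Nontrivial S := IsSimpleModule.nontrivial (MonoidAlgebra ℂ G) S
      refine ⟨bot_ne_top, fun W hW => ?_⟩
      let W' : Submodule (MonoidAlgebra ℂ G) S :=
        { W with
          smul_mem' := by
            intro b v hv
            change v ∈ W at hv
            change b • v ∈ W
            induction b using MonoidAlgebra.induction_linear with
            | zero => simp
            | add x y hx hy => rw [add_smul]; exact W.add_mem hx hy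
            | single g c => rw [hsingle]; exact W.smul_mem c (hW g v hv) }
      have hmem : ∀ v, v ∈ W' ↔ v ∈ W := fun v => Iff.rfl
      rcases eq_bot_or_eq_top W' with h | h
      · left
        ext v
        rw [← hmem, h, Submodule.mem_bot, Submodule.mem_bot]
      · right
        ext v
        rw [← hmem, h]
        simp
    refine Module.mem_annihilator.2 fun v => ?_
    have h0 := LinearMap.congr_fun (hf S τ hirr) v
    rw [opOf_apply] at h0
    simpa [a, Finset.sum_smul, hsingle] using h0
  have ha0 : a = 0 := by
    simpa using Submodule.mem_annihilator.1 ha 1 Submodule.mem_top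
  ext g
  have h := congrArg (fun b : MonoidAlgebra ℂ G => b.coeff g) ha0
  simpa [a, Finsupp.single_apply] using h

end FourierTransform

end GK

namespace GK

section Trace

theorem trace_pi_eq_sum {ι : Type} [Fintype ι] {M : ι → Type} [∀ i, AddCommGroup (M i)]
    [∀ i, Module ℂ (M i)] [∀ i, FiniteDimensional ℂ (M i)] (F : (∀ i, M i) →ₗ[ℂ] ∀ i, M i) :
    LinearMap.trace ℂ _ F =
      ∑ i, LinearMap.trace ℂ (M i) (LinearMap.proj i ∘ₗ F ∘ₗ LinearMap.single ℂ M i) := by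
  have h : F = ∑ i, F ∘ₗ LinearMap.single ℂ M i ∘ₗ LinearMap.proj i := by
    refine LinearMap.ext fun x => ?_
    simp only [LinearMap.sum_apply, LinearMap.comp_apply, LinearMap.proj_apply,
      LinearMap.single_apply, ← map_sum, Finset.univ_sum_single]
  conv_lhs => rw [h]
  rw [map_sum]
  refine Finset.sum_congr rfl fun i _ => ?_
  rw [← LinearMap.comp_assoc, LinearMap.trace_comp_comm']

variable {V : Type} [AddCommGroup V] [Module ℂ V] [FiniteDimensional ℂ V]

omit [FiniteDimensional ℂ V] in
theorem trace_eq_sum_repr {ι : Type} [Fintype ι] (b : Module.Basis ι ℂ V) (f : V →ₗ[ℂ] V) :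
    LinearMap.trace ℂ V f = ∑ i, b.repr (f (b i)) i := by
  rw [LinearMap.trace_eq_matrix_trace ℂ b]
  simp [Matrix.trace, LinearMap.toMatrix_apply]

omit [FiniteDimensional ℂ V] in
theorem trace_end_eq_sum_repr {ι : Type} [Fintype ι] (b : Module.Basis ι ℂ V)
    (S : (V →ₗ[ℂ] V) →ₗ[ℂ] V →ₗ[ℂ] V) :
    LinearMap.trace ℂ _ S =
      ∑ i, ∑ j, b.repr (S ((b.coord j).smulRight (b i)) (b j)) i := by
  rw [trace_eq_sum_repr (b.linearMap b) S, Fintype.sum_prod_type]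
  refine Finset.sum_congr rfl fun i _ => Finset.sum_congr rfl fun j _ => ?_
  have : b.linearMap b (i, j) = (b.coord j).smulRight (b i) := by
    refine b.ext fun k => ?_
    rw [Module.Basis.linearMap_apply_apply]
    simp [Finsupp.single_apply, eq_comm]
  rw [this, Module.Basis.linearMap_repr_apply]
  exact LinearMap.toMatrix_apply b b _ i j

theorem trace_mulLeft_mulRight (P Q : V →ₗ[ℂ] V) (S : (V →ₗ[ℂ] V) →ₗ[ℂ] V →ₗ[ℂ] V)
    (hS : ∀ A, S A = P ∘ₗ A ∘ₗ Q) :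
    LinearMap.trace ℂ _ S = LinearMap.trace ℂ V P * LinearMap.trace ℂ V Q := by
  let b := Module.finBasis ℂ V
  rw [trace_end_eq_sum_repr b, trace_eq_sum_repr b, trace_eq_sum_repr b, Finset.sum_mul_sum]
  refine Finset.sum_congr rfl fun i _ => Finset.sum_congr rfl fun j _ => ?_
  simp [hS, mul_comm]

theorem trace_comp_dualMap_comp (X : (V →ₗ[ℂ] ℂ) →ₗ[ℂ] V) (Y : V →ₗ[ℂ] V →ₗ[ℂ] ℂ)
    (S : (V →ₗ[ℂ] V) →ₗ[ℂ] V →ₗ[ℂ] V) (hS : ∀ A w, S A w = X (Y w ∘ₗ A)) :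
    LinearMap.trace ℂ _ S = LinearMap.trace ℂ V (X ∘ₗ Y.flip) := by
  let b := Module.finBasis ℂ V
  rw [trace_end_eq_sum_repr b, trace_eq_sum_repr b]
  refine Finset.sum_congr rfl fun i _ => ?_
  have h1 : ∀ j, Y (b j) ∘ₗ (b.coord j).smulRight (b i) = Y (b j) (b i) • b.coord j := fun j => by
    ext v
    simp [mul_comm]
  have h2 : Y.flip (b i) = ∑ j, Y (b j) (b i) • b.coord j := by
    refine b.ext fun k => ?_
    simp [Finsupp.single_apply, LinearMap.sum_apply]
  simp only [hS, h1, LinearMap.comp_apply, h2, map_sum, map_smul, Finsupp.coe_finsetSum,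
    Finset.sum_apply]

end Trace

section PeterWeyl

variable {G : Type} [Group G] [Fintype G] {ι : Type} [Fintype ι] {Vf : ι → Type}
  [∀ i, AddCommGroup (Vf i)] [∀ i, Module ℂ (Vf i)] [∀ i, FiniteDimensional ℂ (Vf i)]
  {π : ∀ i, Representation ℂ G (Vf i)}

theorem bijective_opOf (hirr : ∀ i, IsIrred (π i))
    (hdistinct : ∀ i j, RepIso (π i) (π j) → i = j)
    (hcomplete : ∀ (W : Type) [AddCommGroup W] [Module ℂ W] [FiniteDimensional ℂ W]
      (τ : Representation ℂ G W), IsIrred τ → ∃ i, RepIso τ (π i)) :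
    Function.Bijective (LinearMap.pi fun i => opOf (π i)) := by
  constructor
  · rw [← LinearMap.ker_eq_bot, LinearMap.ker_eq_bot']
    intro f hf
    refine eq_zero_of_opOf_eq_zero f fun W _ _ _ τ hτ => ?_
    obtain ⟨i, hi⟩ := hcomplete W τ hτ
    exact opOf_eq_zero_of_repIso hi (congrFun hf i)
  · rw [← LinearMap.range_eq_top, eq_top_iff]
    rintro A -
    rw [← Finset.univ_sum_single A]
    refine Submodule.sum_mem _ fun i _ => ?_
    let b := Module.finBasis ℂ (Vf i)
    have hA : A i = ∑ j, (b.coord j).smulRight (A i (b j)) := by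
      refine b.ext fun k => ?_
      simp [LinearMap.sum_apply, Finsupp.single_apply]
    rw [hA, ← LinearMap.single_apply (R := ℂ), map_sum]
    refine Submodule.sum_mem _ fun j _ => ?_
    have : Nontrivial (Vf i) := (Submodule.nontrivial_iff ℂ).1 ⟨⊥, ⊤, (hirr i).1⟩
    have hd : (Module.finrank ℂ (Vf i) : ℂ) ≠ 0 := by
      exact_mod_cast (Module.finrank_pos (R := ℂ) (M := Vf i)).ne'
    have hG : (Fintype.card G : ℂ) ≠ 0 := by simp
    refine ⟨((Module.finrank ℂ (Vf i) : ℂ) / Fintype.card G) •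
      coeffInv (π i) (b.coord j) (A i (b j)), funext fun k => ?_⟩
    rw [LinearMap.pi_apply, map_smul, LinearMap.single_apply]
    rcases eq_or_ne k i with rfl | hk
    · rw [opOf_coeffInv_self (hirr k), Pi.single_eq_same, smul_smul]
      rw [div_mul_div_cancel₀ hG, div_self hd, one_smul]
    · rw [opOf_coeffInv_of_not_repIso (hirr i) (hirr k) fun h => hk (hdistinct _ _ h).symm,
        Pi.single_eq_of_ne hk, smul_zero]

/-- The trace of an operator on functions on `G` is the sum of the traces of its diagonal blocks
in the decomposition of the group algebra as a product of matrix algebras. -/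
theorem trace_eq_sum_of_opOf (hirr : ∀ i, IsIrred (π i))
    (hdistinct : ∀ i j, RepIso (π i) (π j) → i = j)
    (hcomplete : ∀ (W : Type) [AddCommGroup W] [Module ℂ W] [FiniteDimensional ℂ W]
      (τ : Representation ℂ G W), IsIrred τ → ∃ i, RepIso τ (π i))
    (S : (G → ℂ) →ₗ[ℂ] G → ℂ) (t : ι → ℂ)
    (h : ∀ i, ∀ R : (Vf i →ₗ[ℂ] Vf i) →ₗ[ℂ] Vf i →ₗ[ℂ] Vf i,
      (∀ f, (∀ j, j ≠ i → opOf (π j) f = 0) → R (opOf (π i) f) = opOf (π i) (S f)) →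
        LinearMap.trace ℂ _ R = t i) :
    LinearMap.trace ℂ _ S = ∑ i, t i := by
  let T : (G → ℂ) ≃ₗ[ℂ] ∀ i, Vf i →ₗ[ℂ] Vf i :=
    LinearEquiv.ofBijective _ (bijective_opOf hirr hdistinct hcomplete)
  have hT : ∀ f i, T f i = opOf (π i) f := fun f i => rfl
  rw [← LinearMap.trace_conj' S T, trace_pi_eq_sum]
  refine Finset.sum_congr rfl fun i _ => h i _ fun f hf => ?_
  have hf' : LinearMap.single ℂ (fun i => Vf i →ₗ[ℂ] Vf i) i (opOf (π i) f) = T f := by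
    funext j
    rw [LinearMap.single_apply, hT]
    rcases eq_or_ne j i with rfl | hj
    · rw [Pi.single_eq_same]
    · rw [Pi.single_eq_of_ne hj, hf j hj]
  rw [LinearMap.comp_apply, LinearMap.comp_apply, hf', LinearMap.proj_apply,
    LinearEquiv.conj_apply_apply, LinearEquiv.symm_apply_apply, hT]

/-- Every endomorphism of `Vf i` is the action of a function on `G` which acts by zero on the other
irreducible representations. -/
theorem exists_opOf_eq (hirr : ∀ i, IsIrred (π i))
    (hdistinct : ∀ i j, RepIso (π i) (π j) → i = j)
    (hcomplete : ∀ (W : Type) [AddCommGroup W] [Module ℂ W] [FiniteDimensional ℂ W]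
      (τ : Representation ℂ G W), IsIrred τ → ∃ i, RepIso τ (π i))
    (i : ι) (A : Vf i →ₗ[ℂ] Vf i) :
    ∃ f, opOf (π i) f = A ∧ ∀ j, j ≠ i → opOf (π j) f = 0 := by
  obtain ⟨f, hf⟩ := (bijective_opOf hirr hdistinct hcomplete).2 (Pi.single i A)
  refine ⟨f, ?_, fun j hj => ?_⟩
  · simpa using congrFun hf i
  · simpa [hj] using congrFun hf j

end PeterWeyl

end GK

namespace GK

section Average

variable {G : Type} [Group G] {V : Type} [AddCommGroup V] [Module ℂ V]

/-- The twisted representation `π ∘ θ`. -/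
abbrev twist (θ : G ≃* G) (π : Representation ℂ G V) : Representation ℂ G V :=
  π.comp θ.toMonoidHom

theorem twist_apply (θ : G ≃* G) (π : Representation ℂ G V) (g : G) : twist θ π g = π (θ g) := rfl

theorem invariantsOf_twist (θ : G ≃* G) (π : Representation ℂ G V) (H : Subgroup G) :
    invariantsOf (twist θ π) H = invariantsOf π (H.map θ.toMonoidHom) := by
  ext v
  change (∀ h ∈ H, π (θ h) v = v) ↔ ∀ h ∈ H.map θ.toMonoidHom, π h v = v
  simp

theorem finrank_invariantsOf_twist (θ : G ≃* G) (π : Representation ℂ G V) (H : Subgroup G) :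
    Module.finrank ℂ (invariantsOf (twist θ π) H) =
      Module.finrank ℂ (invariantsOf π (H.map θ.toMonoidHom)) := by
  rw [invariantsOf_twist]

variable [Fintype G]

/-- The averaging operator `|H|⁻¹ ∑ h ∈ H, π h`. -/
def avg (π : Representation ℂ G V) (H : Subgroup G) : V →ₗ[ℂ] V :=
  (Fintype.card H : ℂ)⁻¹ • ∑ h : H, π h

theorem avg_eq_sum_inv (π : Representation ℂ G V) (H : Subgroup G) :
    avg π H = (Fintype.card H : ℂ)⁻¹ • ∑ h : H, π (h : G)⁻¹ := by
  rw [avg, ← Equiv.sum_comp (Equiv.inv H)]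
  simp

theorem isProj_avg (π : Representation ℂ G V) (H : Subgroup G) :
    LinearMap.IsProj (invariantsOf π H) (avg π H) := by
  constructor
  · intro v h hh
    simp only [avg, LinearMap.smul_apply, LinearMap.sum_apply, map_smul, map_sum]
    congr 1
    refine Fintype.sum_equiv (Equiv.mulLeft (⟨h, hh⟩ : H)) _ _ fun x => ?_
    simp
  · intro v hv
    have h1 : ∀ h : H, π h v = v := fun h => hv h h.2
    simp [avg, LinearMap.sum_apply, h1, ← Nat.cast_smul_eq_nsmul ℂ, smul_smul]

theorem avg_comp_avg (π : Representation ℂ G V) (H : Subgroup G) (v : V) :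
    avg π H (avg π H v) = avg π H v :=
  (isProj_avg π H).map_id _ ((isProj_avg π H).map_mem v)

theorem trace_avg [FiniteDimensional ℂ V] (π : Representation ℂ G V) (H : Subgroup G) :
    LinearMap.trace ℂ V (avg π H) = Module.finrank ℂ (invariantsOf π H) :=
  (isProj_avg π H).trace

/-- Averaging functions on `G` over left translations by `H` and right translations by `θ H`. -/
def biavg (θ : G ≃* G) (H : Subgroup G) : (G → ℂ) →ₗ[ℂ] G → ℂ :=
  ((Fintype.card H : ℂ)⁻¹ * (Fintype.card H : ℂ)⁻¹) •
    ∑ h : H, ∑ k : H, LinearMap.funLeft ℂ ℂ fun g : G => h * g * θ k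

theorem biavg_apply (θ : G ≃* G) (H : Subgroup G) (f : G → ℂ) (g : G) :
    biavg θ H f g = ((Fintype.card H : ℂ)⁻¹ * (Fintype.card H : ℂ)⁻¹) *
      ∑ h : H, ∑ k : H, f (h * g * θ k) := by
  simp [biavg, LinearMap.sum_apply, Finset.sum_apply, LinearMap.funLeft_apply]

/-- Composing functions on `G` with the anti-involution `g ↦ θ g⁻¹`. -/
def antiInv (θ : G ≃* G) : (G → ℂ) →ₗ[ℂ] G → ℂ := LinearMap.funLeft ℂ ℂ fun g : G => θ g⁻¹

omit [Fintype G] in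
theorem antiInv_apply (θ : G ≃* G) (f : G → ℂ) (g : G) : antiInv θ f g = f (θ g⁻¹) := rfl

theorem biavg_mul_left (θ : G ≃* G) (H : Subgroup G) (f : G → ℂ) (x : G) (hx : x ∈ H) (g : G) :
    biavg θ H f (x * g) = biavg θ H f g := by
  rw [biavg_apply, biavg_apply]
  congr 1
  refine Fintype.sum_equiv (Equiv.mulRight (⟨x, hx⟩ : H)) _ _ fun h => ?_
  simp [mul_assoc]

theorem biavg_mul_right (θ : G ≃* G) (H : Subgroup G) (f : G → ℂ) (x : G) (hx : x ∈ H) (g : G) :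
    biavg θ H f (g * θ x) = biavg θ H f g := by
  rw [biavg_apply, biavg_apply]
  congr 1
  refine Finset.sum_congr rfl fun h _ => ?_
  refine Fintype.sum_equiv (Equiv.mulLeft (⟨x, hx⟩ : H)) _ _ fun k => ?_
  simp [mul_assoc]

/-- The projection onto `funSpaceV θ H`. -/
theorem isProj_funSpaceV (θ : G ≃* G) (hθ : ∀ g : G, θ (θ g) = g) (H : Subgroup G) :
    LinearMap.IsProj (funSpaceV θ H)
      ((1 / 2 : ℂ) • (biavg θ H - antiInv θ ∘ₗ biavg θ H)) := by
  have happ : ∀ f g, ((1 / 2 : ℂ) • (biavg θ H - antiInv θ ∘ₗ biavg θ H)) f g =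
      1 / 2 * (biavg θ H f g - biavg θ H f (θ g⁻¹)) := fun f g => rfl
  constructor
  · refine fun f => ⟨fun h hh g => ?_, ?_, fun g => ?_⟩
    · rw [happ, happ, biavg_mul_left _ _ _ _ hh, mul_inv_rev, map_mul,
        biavg_mul_right _ _ _ _ (H.inv_mem hh)]
    · rintro _ ⟨h, hh, rfl⟩ g
      rw [happ, happ]
      change 1 / 2 * (biavg θ H f (g * θ h) - biavg θ H f (θ (g * θ h)⁻¹)) = _
      rw [biavg_mul_right _ _ _ _ hh, mul_inv_rev, map_mul, ← map_inv, hθ,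
        biavg_mul_left _ _ _ _ (H.inv_mem hh)]
    · rw [happ, happ, ← map_inv, hθ, inv_inv]
      ring
  · rintro f ⟨h1, h2, h3⟩
    have hf : ∀ g, biavg θ H f g = f g := fun g => by
      rw [biavg_apply]
      have : ∀ h k : H, f (h * g * θ k) = f g := fun h k => by
        rw [h2 (θ k) ⟨k, k.2, rfl⟩, h1 h h.2]
      simp only [this, Finset.sum_const, Finset.card_univ, nsmul_eq_mul]
      field_simp
    funext g
    rw [happ, hf, hf, h3]
    ring

theorem opOf_biavg (θ : G ≃* G) (H : Subgroup G) (π : Representation ℂ G V) (f : G → ℂ) :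
    opOf π (biavg θ H f) = avg π H ∘ₗ opOf π f ∘ₗ avg (twist θ π) H := by
  have key : ∀ h k : H, opOf π (LinearMap.funLeft ℂ ℂ (fun g : G => h * g * θ k) f) =
      π (h : G)⁻¹ ∘ₗ opOf π f ∘ₗ π (θ (k : G)⁻¹) := fun h k => by
    ext v
    simp only [opOf_apply, LinearMap.comp_apply, map_sum, map_smul, LinearMap.funLeft_apply]
    refine Fintype.sum_equiv ((Equiv.mulLeft (h : G)).trans (Equiv.mulRight (θ k))) _ _
      fun g => ?_
    simp [← Module.End.mul_apply, ← map_mul, mul_assoc]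
  ext v
  rw [avg_eq_sum_inv, avg_eq_sum_inv]
  simp only [biavg, LinearMap.smul_apply, LinearMap.sum_apply, map_smul, map_sum, key,
    LinearMap.comp_apply, twist_apply]
  rw [Finset.sum_comm, ← Finset.smul_sum, smul_smul]

end Average

section InvariantForm

variable {G : Type} [Group G] {V : Type} [AddCommGroup V] [Module ℂ V]

theorem exists_form_of_eps_ne_zero {θ : G ≃* G} {π : Representation ℂ G V} (h : eps θ π ≠ 0) :
    ∃ B : V →ₗ[ℂ] V →ₗ[ℂ] ℂ, B ≠ 0 ∧ (∀ v w, B v w = (eps θ π : ℂ) * B w v) ∧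
      ∀ (g : G) (v w : V), B (π g v) w = B v (π (θ g⁻¹) w) := by
  by_cases h1 : HasSymForm θ π
  · have he : eps θ π = 1 := if_pos h1
    obtain ⟨B, h0, hB, hB'⟩ := h1
    exact ⟨B, h0, fun v w => by rw [he, hB]; simp, hB'⟩
  · by_cases h2 : HasAltForm θ π
    · have he : eps θ π = -1 := by rw [eps, if_neg h1, if_pos h2]
      obtain ⟨B, h0, hB, hB'⟩ := h2
      exact ⟨B, h0, fun v w => by rw [he, hB]; simp, hB'⟩
    · exact absurd (by rw [eps, if_neg h1, if_neg h2]) h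

theorem eps_eq (θ : G ≃* G) (π : Representation ℂ G V) :
    eps θ π = 0 ∨ eps θ π = 1 ∨ eps θ π = -1 := by
  unfold eps
  split_ifs <;> simp

theorem form_eq_zero_of_eps_eq_zero {θ : G ≃* G} (hθ : ∀ g : G, θ (θ g) = g)
    {π : Representation ℂ G V} (h : eps θ π = 0) (B : V →ₗ[ℂ] V →ₗ[ℂ] ℂ)
    (hB : ∀ (g : G) (v w : V), B (π g v) w = B v (π (θ g⁻¹) w)) : B = 0 := by
  have h1 : ¬ HasSymForm θ π := fun h1 => by simp [eps, h1] at h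
  have h2 : ¬ HasAltForm θ π := fun h2 => by simp [eps, h1, h2] at h
  have hflip : ∀ (g : G) (v w : V), B w (π g v) = B (π (θ g⁻¹) w) v := fun g v w => by
    rw [hB, ← map_inv, hθ, inv_inv]
  have hs : B + B.flip = 0 := by
    by_contra h0
    refine h1 ⟨B + B.flip, h0, fun v w => ?_, fun g v w => ?_⟩
    · simp [add_comm]
    · simp [hB g v w, hflip g v w]
  have ha : B - B.flip = 0 := by
    by_contra h0
    refine h2 ⟨B - B.flip, h0, fun v w => ?_, fun g v w => ?_⟩
    · simp
    · simp [hB g v w, hflip g v w]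
  ext v w
  have e1 := LinearMap.congr_fun (LinearMap.congr_fun hs v) w
  have e2 := LinearMap.congr_fun (LinearMap.congr_fun ha v) w
  simp only [LinearMap.add_apply, LinearMap.sub_apply, LinearMap.flip_apply,
    LinearMap.zero_apply] at e1 e2 ⊢
  linear_combination (e1 + e2) / 2

theorem isIrred_dual_twist [FiniteDimensional ℂ V] {θ : G ≃* G} {π : Representation ℂ G V}
    (hπ : IsIrred π) : IsIrred (twist θ π).dual := by
  have : Nontrivial V := (Submodule.nontrivial_iff ℂ).1 ⟨⊥, ⊤, hπ.1⟩
  refine ⟨bot_ne_top, fun W hW => ?_⟩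
  have hW' : ∀ g : G, ∀ v ∈ W.dualCoannihilator, π g v ∈ W.dualCoannihilator := by
    intro g v hv
    rw [Submodule.mem_dualCoannihilator] at hv ⊢
    intro l hl
    have := hv _ (hW (θ.symm g⁻¹) l hl)
    simpa [Representation.dual_apply, Module.Dual.transpose_apply, twist_apply] using this
  rw [← Subspace.dualCoannihilator_dualAnnihilator_eq (W := W)]
  rcases hπ.2 _ hW' with h | h
  · right
    simp [h]
  · left
    simp [h]

/-- A nonzero invariant form on an irreducible representation, viewed as an isomorphism with the
dual space. -/
theorem exists_dual_equiv [FiniteDimensional ℂ V] {θ : G ≃* G} {π : Representation ℂ G V}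
    (hπ : IsIrred π) (B : V →ₗ[ℂ] V →ₗ[ℂ] ℂ) (h0 : B ≠ 0)
    (hB : ∀ (g : G) (v w : V), B (π g v) w = B v (π (θ g⁻¹) w)) :
    ∃ J : V ≃ₗ[ℂ] (V →ₗ[ℂ] ℂ), ∀ v, J v = B v := by
  have hker : LinearMap.ker B = ⊥ := by
    refine (hπ.2 (LinearMap.ker B) fun g v hv => ?_).resolve_right
      fun h => h0 (LinearMap.ker_eq_top.1 h)
    rw [LinearMap.mem_ker] at hv ⊢
    ext w
    rw [hB, hv]
    rfl
  exact ⟨LinearEquiv.ofInjectiveOfFinrankEq B (LinearMap.ker_eq_bot.1 hker)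
    (Subspace.dual_finrank_eq (K := ℂ) (V := V)).symm, fun v => rfl⟩

variable [Fintype G]

theorem opOf_antiInv_eq_zero {θ : G ≃* G} {π : Representation ℂ G V} {f : G → ℂ}
    (hf : opOf (twist θ π).dual f = 0) (hθ : ∀ g : G, θ (θ g) = g) :
    opOf π (antiInv θ f) = 0 := by
  ext v
  rw [LinearMap.zero_apply, ← Module.forall_dual_apply_eq_zero_iff ℂ]
  intro l
  have h := LinearMap.congr_fun (LinearMap.congr_fun hf l) v
  simp only [opOf_apply, LinearMap.sum_apply, LinearMap.zero_apply, map_sum, map_smul,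
    LinearMap.smul_apply, Representation.dual_apply, Module.Dual.transpose_apply,
    LinearMap.comp_apply, twist_apply] at h ⊢
  rw [← h]
  refine Fintype.sum_equiv ((Equiv.inv G).trans θ.toEquiv) _ _ fun g => ?_
  simp [antiInv_apply, hθ]

end InvariantForm

end GK

namespace GK

section TraceFormula

variable {G : Type} [Group G] [Fintype G] {V : Type} [AddCommGroup V] [Module ℂ V]
  {θ : G ≃* G} {π : Representation ℂ G V} {B : V →ₗ[ℂ] V →ₗ[ℂ] ℂ} {s : ℂ}

omit [Fintype G] in
theorem form_comp_rep (hs : ∀ v w, B v w = s * B w v)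
    (hB : ∀ (g : G) (v w : V), B (π g v) w = B v (π (θ g⁻¹) w)) (g : G) (w : V) :
    B w ∘ₗ π g = B (π (θ g⁻¹) w) := by
  ext v
  rw [LinearMap.comp_apply, hs w, hB, ← hs]

theorem form_comp_opOf (hs : ∀ v w, B v w = s * B w v)
    (hB : ∀ (g : G) (v w : V), B (π g v) w = B v (π (θ g⁻¹) w)) (hθ : ∀ g : G, θ (θ g) = g)
    (f : G → ℂ) (w : V) : B (opOf π (antiInv θ f) w) = B w ∘ₗ opOf π f := by
  have h : B w ∘ₗ opOf π f = ∑ g, f g • (B w ∘ₗ π g) := by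
    ext v
    simp [opOf_apply, LinearMap.sum_apply]
  rw [h, opOf_apply, map_sum]
  refine Fintype.sum_equiv ((Equiv.inv G).trans θ.toEquiv) _ _ fun g => ?_
  simp [form_comp_rep hs hB, antiInv_apply, hθ]

theorem form_comp_avg (hs : ∀ v w, B v w = s * B w v)
    (hB : ∀ (g : G) (v w : V), B (π g v) w = B v (π (θ g⁻¹) w)) (H : Subgroup G) (w : V) :
    B w ∘ₗ avg π H = B (avg (twist θ π) H w) := by
  have h : B w ∘ₗ avg π H = (Fintype.card H : ℂ)⁻¹ • ∑ h : H, (B w ∘ₗ π h) := by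
    ext v
    simp [avg, LinearMap.sum_apply]
  rw [h, avg_eq_sum_inv]
  simp [form_comp_rep hs hB, LinearMap.sum_apply, twist_apply]

theorem form_comp_avg_twist (hs : ∀ v w, B v w = s * B w v)
    (hB : ∀ (g : G) (v w : V), B (π g v) w = B v (π (θ g⁻¹) w)) (hθ : ∀ g : G, θ (θ g) = g)
    (H : Subgroup G) (w : V) :
    B w ∘ₗ avg (twist θ π) H = B (avg π H w) := by
  have h : B w ∘ₗ avg (twist θ π) H = (Fintype.card H : ℂ)⁻¹ • ∑ h : H, (B w ∘ₗ π (θ h)) := by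
    ext v
    simp [avg, LinearMap.sum_apply, twist_apply]
  rw [h, avg_eq_sum_inv]
  simp [form_comp_rep hs hB, LinearMap.sum_apply, ← map_inv, hθ]

variable [FiniteDimensional ℂ V]

theorem trace_avg_twist_of_eps_ne_zero (hπ : IsIrred π) (heps : eps θ π ≠ 0) (H : Subgroup G) :
    LinearMap.trace ℂ V (avg (twist θ π) H) = LinearMap.trace ℂ V (avg π H) := by
  obtain ⟨B, h0, hs, hB⟩ := exists_form_of_eps_ne_zero heps
  obtain ⟨J, hJ⟩ := exists_dual_equiv hπ B h0 hB
  rw [← LinearMap.trace_transpose' (avg π H), ← LinearMap.trace_conj' _ J]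
  congr 1
  refine LinearMap.ext fun l => ?_
  obtain ⟨w, rfl⟩ := J.surjective l
  rw [LinearEquiv.conj_apply_apply, J.symm_apply_apply, Module.Dual.transpose_apply, hJ, hJ,
    form_comp_avg hs hB]

theorem trace_block_of_eps_ne_zero (hθ : ∀ g : G, θ (θ g) = g) (hπ : IsIrred π)
    (heps : eps θ π ≠ 0) (H : Subgroup G) (R : (V →ₗ[ℂ] V) →ₗ[ℂ] V →ₗ[ℂ] V)
    (hR : ∀ A, ∃ f, opOf π f = A ∧ R A = opOf π (antiInv θ (biavg θ H f))) :
    LinearMap.trace ℂ _ R = eps θ π * LinearMap.trace ℂ V (avg π H) := by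
  obtain ⟨B, h0, hs, hB⟩ := exists_form_of_eps_ne_zero heps
  obtain ⟨J, hJ⟩ := exists_dual_equiv hπ B h0 hB
  have hsymm : ∀ v, J.symm (B v) = v := fun v => by rw [← hJ, J.symm_apply_apply]
  let X : (V →ₗ[ℂ] ℂ) →ₗ[ℂ] V := J.symm.toLinearMap ∘ₗ Module.Dual.transpose (avg (twist θ π) H)
  let Y : V →ₗ[ℂ] V →ₗ[ℂ] ℂ := B ∘ₗ avg (twist θ π) H
  rw [trace_comp_dualMap_comp X Y R fun A w => ?_, ← smul_eq_mul, ← map_smul]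
  · congr 1
    ext v
    have hY : Y.flip v = (eps θ π : ℂ) • B (avg π H v) := by
      ext w
      change B (avg (twist θ π) H w) v = _
      rw [← form_comp_avg hs hB, LinearMap.comp_apply, hs, LinearMap.smul_apply, smul_eq_mul]
    change J.symm (Y.flip v ∘ₗ avg (twist θ π) H) = _
    rw [hY, LinearMap.smul_comp, form_comp_avg_twist hs hB hθ, avg_comp_avg, map_smul, hsymm,
      LinearMap.smul_apply]
  · obtain ⟨f, rfl, hf⟩ := hR A
    apply J.injective
    change J (R (opOf π f) w) =
      J (J.symm ((B (avg (twist θ π) H w) ∘ₗ opOf π f) ∘ₗ avg (twist θ π) H))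
    rw [J.apply_symm_apply, hf, hJ, form_comp_opOf hs hB hθ, opOf_biavg, ← LinearMap.comp_assoc,
      form_comp_avg hs hB]
    rfl

variable {ι : Type} [Fintype ι] {Vf : ι → Type}
  [∀ i, AddCommGroup (Vf i)] [∀ i, Module ℂ (Vf i)] [∀ i, FiniteDimensional ℂ (Vf i)]
  {ρ : ∀ i, Representation ℂ G (Vf i)}

theorem trace_biavg (θ : G ≃* G) (H : Subgroup G) (hirr : ∀ i, IsIrred (ρ i))
    (hdistinct : ∀ i j, RepIso (ρ i) (ρ j) → i = j)
    (hcomplete : ∀ (W : Type) [AddCommGroup W] [Module ℂ W] [FiniteDimensional ℂ W]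
      (τ : Representation ℂ G W), IsIrred τ → ∃ i, RepIso τ (ρ i)) :
    LinearMap.trace ℂ _ (biavg θ H) = ∑ i, LinearMap.trace ℂ (Vf i) (avg (ρ i) H) *
      LinearMap.trace ℂ (Vf i) (avg (twist θ (ρ i)) H) := by
  refine trace_eq_sum_of_opOf hirr hdistinct hcomplete _ _ fun i R hR => ?_
  refine trace_mulLeft_mulRight (avg (ρ i) H) (avg (twist θ (ρ i)) H) R fun A => ?_
  obtain ⟨f, rfl, hf⟩ := exists_opOf_eq hirr hdistinct hcomplete i A
  rw [hR f hf, opOf_biavg]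

theorem trace_antiInv_comp_biavg (hθ : ∀ g : G, θ (θ g) = g) (H : Subgroup G)
    (hirr : ∀ i, IsIrred (ρ i)) (hdistinct : ∀ i j, RepIso (ρ i) (ρ j) → i = j)
    (hcomplete : ∀ (W : Type) [AddCommGroup W] [Module ℂ W] [FiniteDimensional ℂ W]
      (τ : Representation ℂ G W), IsIrred τ → ∃ i, RepIso τ (ρ i)) :
    LinearMap.trace ℂ _ (antiInv θ ∘ₗ biavg θ H) =
      ∑ i, (eps θ (ρ i) : ℂ) * LinearMap.trace ℂ (Vf i) (avg (ρ i) H) := by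
  refine trace_eq_sum_of_opOf hirr hdistinct hcomplete _ _ fun i R hR => ?_
  by_cases heps : eps θ (ρ i) = 0
  · rw [heps, Int.cast_zero, zero_mul]
    suffices R = 0 by rw [this, map_zero]
    refine LinearMap.ext fun A => ?_
    obtain ⟨f, rfl, hf⟩ := exists_opOf_eq hirr hdistinct hcomplete i A
    rw [hR f hf, LinearMap.zero_apply]
    refine opOf_antiInv_eq_zero (π := ρ i) (f := biavg θ H f) ?_ hθ
    obtain ⟨j, hj⟩ := hcomplete (Module.Dual ℂ (Vf i)) (twist θ (ρ i)).dual
      (isIrred_dual_twist (hirr i))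
    refine opOf_eq_zero_of_repIso hj ?_
    have hji : j ≠ i := by
      rintro rfl
      obtain ⟨e, he⟩ := hj
      have hB := form_eq_zero_of_eps_eq_zero hθ heps e.symm.toLinearMap fun g v w => by
        obtain ⟨l, rfl⟩ := e.surjective v
        change e.symm (ρ j g (e l)) w = e.symm (e l) _
        rw [← he, e.symm_apply_apply, e.symm_apply_apply]
        rfl
      have : Nontrivial (Vf j) := (Submodule.nontrivial_iff ℂ).1 ⟨⊥, ⊤, (hirr j).1⟩
      obtain ⟨v, hv⟩ := exists_ne (0 : Vf j)
      exact hv (e.symm.map_eq_zero_iff.1 (LinearMap.congr_fun hB v))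
    rw [opOf_biavg, hf j hji]
    simp
  · refine trace_block_of_eps_ne_zero hθ (hirr i) heps H R fun A => ?_
    obtain ⟨f, rfl, hf⟩ := exists_opOf_eq hirr hdistinct hcomplete i A
    exact ⟨f, rfl, hR f hf⟩

end TraceFormula

end GK

/-- The dimension of the space of left `H`-invariant, right `θ(H)`-invariant,
`σ`-anti-invariant functions on `G` is
`(1/2)·∑_{ε=0} dim(π^H)·dim(π^{θ(H)}) + ∑_{ε=1} C(dim π^H, 2) + ∑_{ε=-1} C(dim π^H + 1, 2)`,
summing over a complete set of pairwise non-isomorphic irreducible representations. -/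
theorem finrank_funSpaceV {G : Type} [Group G] [Fintype G]
    (θ : G ≃* G) (hθ : ∀ g : G, θ (θ g) = g)
    (H : Subgroup G)
    (ι : Type) [Fintype ι] (Vf : ι → Type)
    [∀ i, AddCommGroup (Vf i)] [∀ i, Module ℂ (Vf i)] [∀ i, FiniteDimensional ℂ (Vf i)]
    (π : ∀ i, Representation ℂ G (Vf i))
    (hirr : ∀ i, GK.IsIrred (π i))
    (hdistinct : ∀ i j, GK.RepIso (π i) (π j) → i = j)
    (hcomplete : ∀ (W : Type) [AddCommGroup W] [Module ℂ W] [FiniteDimensional ℂ W]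
      (τ : Representation ℂ G W), GK.IsIrred τ → ∃ i, GK.RepIso τ (π i))
    :
    (Module.finrank ℂ (funSpaceV θ H) : ℚ) =
      (1 / 2 : ℚ) * ∑ i ∈ Finset.univ.filter (fun i => GK.eps θ (π i) = 0),
          ((Module.finrank ℂ (GK.invariantsOf (π i) H) : ℚ) *
            (Module.finrank ℂ (GK.invariantsOf (π i) (H.map θ.toMonoidHom)) : ℚ))
        + ∑ i ∈ Finset.univ.filter (fun i => GK.eps θ (π i) = 1),
            ((Module.finrank ℂ (GK.invariantsOf (π i) H)).choose 2 : ℚ)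
        + ∑ i ∈ Finset.univ.filter (fun i => GK.eps θ (π i) = -1),
            ((Module.finrank ℂ (GK.invariantsOf (π i) H) + 1).choose 2 : ℚ) := by
  have htr := (GK.isProj_funSpaceV θ hθ H).trace
  rw [map_smul, map_sub, GK.trace_biavg θ H hirr hdistinct hcomplete,
    GK.trace_antiInv_comp_biavg hθ H hirr hdistinct hcomplete, smul_eq_mul,
    ← Finset.sum_sub_distrib] at htr
  simp only [GK.trace_avg, GK.finrank_invariantsOf_twist] at htr
  have hdim : ∀ i, GK.eps θ (π i) ≠ 0 →
      Module.finrank ℂ (GK.invariantsOf (π i) (H.map θ.toMonoidHom)) =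
        Module.finrank ℂ (GK.invariantsOf (π i) H) := fun i hi => by
    have h := GK.trace_avg_twist_of_eps_ne_zero (hirr i) hi H
    rw [GK.trace_avg, GK.trace_avg, GK.finrank_invariantsOf_twist] at h
    exact_mod_cast h
  have hq : (Module.finrank ℂ (funSpaceV θ H) : ℚ) = 1 / 2 * ∑ i,
      ((Module.finrank ℂ (GK.invariantsOf (π i) H) : ℚ) *
        (Module.finrank ℂ (GK.invariantsOf (π i) (H.map θ.toMonoidHom)) : ℚ) -
        (GK.eps θ (π i) : ℚ) * (Module.finrank ℂ (GK.invariantsOf (π i) H) : ℚ)) := by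
    rw [← Rat.cast_inj (α := ℂ)]
    push_cast
    exact htr.symm
  rw [hq, Finset.mul_sum, Finset.mul_sum, Finset.sum_filter, Finset.sum_filter, Finset.sum_filter,
    ← Finset.sum_add_distrib, ← Finset.sum_add_distrib]
  refine Finset.sum_congr rfl fun i _ => ?_
  rcases GK.eps_eq θ (π i) with h | h | h
  · simp [h]
  · simp only [hdim i (by simp [h]), h, Nat.cast_choose_two]
    norm_num
    ring
  · simp only [hdim i (by simp [h]), h, Nat.cast_choose_two]
    push_cast
    ring
end
end

section
/- Let G be a finite group, θ : G → G an involutive automorphism, and π an irreducible complex representation of G such that π ∘ θ ≅ π*. Then the space of bilinear forms B on π satisfying B(π(g)v, w) = B(v, π(θ(g⁻¹))w) for all g ∈ G and all vectors v, w is one-dimensional, every nonzero such form is nondegenerate, and every such form is either symmetric or antisymmetric. -/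
open scoped Classical TensorProduct

noncomputable section

/-- The space of bilinear forms `B` on `π` satisfying `B(π(g)v, w) = B(v, π(θ(g⁻¹))w)`. -/
def twistedForms {G : Type} [Group G] {V : Type} [AddCommGroup V] [Module ℂ V]
    (θ : G ≃* G) (π : Representation ℂ G V) : Submodule ℂ (V →ₗ[ℂ] V →ₗ[ℂ] ℂ) where
  carrier := {B | ∀ (g : G) (v w : V), B (π g v) w = B v (π (θ g⁻¹) w)}
  add_mem' := by
    intro a b ha hb g v w
    simp [ha g v w, hb g v w]
  zero_mem' := fun _ _ _ => rfl
  smul_mem' := by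
    intro c B hB g v w
    simp [hB g v w]

namespace GK

variable {G : Type} [Group G] {V : Type} [AddCommGroup V] [Module ℂ V]
  {θ : G ≃* G} {π : Representation ℂ G V}

theorem IsIrred.nontrivial (hirr : IsIrred π) : Nontrivial V :=
  (Submodule.nontrivial_iff ℂ).mp ⟨⊥, ⊤, hirr.1⟩

theorem IsIrred.ker_eq_bot_of_mem_twistedForms (hirr : IsIrred π) {B : V →ₗ[ℂ] V →ₗ[ℂ] ℂ}
    (hB : B ∈ twistedForms θ π) (hB0 : B ≠ 0) : LinearMap.ker B = ⊥ := by
  refine (hirr.2 (LinearMap.ker B) fun g v hv ↦ ?_).resolve_right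
    fun h ↦ hB0 (LinearMap.ker_eq_top.mp h)
  rw [LinearMap.mem_ker] at hv ⊢
  ext w
  rw [hB g v w, hv]
  rfl

theorem flip_mem_twistedForms (hθ : ∀ g, θ (θ g) = g) {B : V →ₗ[ℂ] V →ₗ[ℂ] ℂ}
    (hB : B ∈ twistedForms θ π) : B.flip ∈ twistedForms θ π := by
  intro g v w
  have h := hB (θ g⁻¹) w v
  rw [← map_inv, inv_inv, hθ] at h
  exact h.symm

theorem ConjThetaIsoDual.exists_mem_twistedForms_ne_zero [Nontrivial V]
    (hθ : ∀ g, θ (θ g) = g) (hiso : ConjThetaIsoDual θ π) :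
    ∃ B ∈ twistedForms θ π, B ≠ 0 := by
  obtain ⟨e, he⟩ := hiso
  refine ⟨e.toLinearMap, fun g v w ↦ ?_, fun h ↦ ?_⟩
  · have h := LinearMap.congr_fun (he (θ g) v) w
    simpa [hθ, Representation.dual_apply, Module.Dual.transpose_apply] using h
  · obtain ⟨v, hv⟩ := exists_ne (0 : V)
    exact hv (e.map_eq_zero_iff.mp (LinearMap.congr_fun h v))

theorem IsIrred.exists_smul_eq_of_mem_twistedForms [FiniteDimensional ℂ V] (hirr : IsIrred π)
    {B₀ B : V →ₗ[ℂ] V →ₗ[ℂ] ℂ} (hB₀ : B₀ ∈ twistedForms θ π) (hne : B₀ ≠ 0)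
    (hB : B ∈ twistedForms θ π) : ∃ c : ℂ, c • B₀ = B := by
  have := hirr.nontrivial
  let e : V ≃ₗ[ℂ] Module.Dual ℂ V := B₀.linearEquivOfInjective
    (LinearMap.ker_eq_bot.mp (hirr.ker_eq_bot_of_mem_twistedForms hB₀ hne))
    Subspace.dual_finrank_eq.symm
  obtain ⟨c, hc⟩ := Module.End.exists_eigenvalue (e.symm.toLinearMap ∘ₗ B)
  obtain ⟨v, hv⟩ := hc.exists_hasEigenvector
  have hBv : B v = c • B₀ v := by
    have h : e.symm (B v) = c • v := hv.apply_eq_smul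
    rw [LinearEquiv.symm_apply_eq, map_smul] at h
    exact h
  refine ⟨c, (sub_eq_zero.mp ?_).symm⟩
  by_contra h
  have hker := hirr.ker_eq_bot_of_mem_twistedForms
    (sub_mem hB ((twistedForms θ π).smul_mem c hB₀)) h
  exact hv.2 (LinearMap.ker_eq_bot'.mp hker v (by simp [hBv]))

end GK

/-- For an irreducible `π` with `π ∘ θ ≅ π*`, the space of θ-twisted invariant
bilinear forms is one-dimensional, every nonzero such form is nondegenerate, and every such form
is symmetric or antisymmetric. -/
theorem twistedForms_one_dimensional {G : Type} [Group G] [Fintype G]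
    (θ : G ≃* G) (hθ : ∀ g : G, θ (θ g) = g)
    {V : Type} [AddCommGroup V] [Module ℂ V] [FiniteDimensional ℂ V]
    (π : Representation ℂ G V) (hirr : GK.IsIrred π)
    (hiso : GK.ConjThetaIsoDual θ π) :
    Module.finrank ℂ (twistedForms θ π) = 1 ∧
    (∀ B ∈ twistedForms θ π, B ≠ 0 → ∀ v : V, (∀ w : V, B v w = 0) → v = 0) ∧
    (∀ B ∈ twistedForms θ π, (∀ v w, B v w = B w v) ∨ (∀ v w, B v w = - B w v)) := by
  have := hirr.nontrivial
  refine ⟨?_, fun B hB hne v hv ↦ ?_, fun B hB ↦ ?_⟩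
  · obtain ⟨B₀, hB₀, hne⟩ := hiso.exists_mem_twistedForms_ne_zero hθ
    refine (finrank_eq_one_iff_of_nonzero' (⟨B₀, hB₀⟩ : twistedForms θ π)
      fun h ↦ hne (congrArg Subtype.val h)).mpr fun B ↦ ?_
    obtain ⟨c, hc⟩ := hirr.exists_smul_eq_of_mem_twistedForms hB₀ hne B.2
    exact ⟨c, Subtype.ext hc⟩
  · exact LinearMap.ker_eq_bot'.mp (hirr.ker_eq_bot_of_mem_twistedForms hB hne) v
      (LinearMap.ext hv)
  · by_cases hne : B = 0
    · simp [hne]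
    obtain ⟨c, hc⟩ := hirr.exists_smul_eq_of_mem_twistedForms hB hne
      (GK.flip_mem_twistedForms hθ hB)
    have hflip : ∀ v w, c * B v w = B w v := fun v w ↦ LinearMap.congr_fun₂ hc v w
    have hsq : (c * c) • B = (1 : ℂ) • B := by
      ext v w
      simp [mul_assoc, hflip]
    rcases mul_self_eq_one_iff.mp (smul_left_injective ℂ hne hsq) with rfl | rfl
    · exact .inl fun v w ↦ by simpa using hflip v w
    · exact .inr fun v w ↦ by simp [← hflip v w]
end
end

section
/- Let G be a finite group, θ : G → G an involutive automorphism, and π an irreducible complex representation of G. Consider the diagonal G-invariants W = ((π ∘ θ) ⊗ π)^{ΔG} of the tensor product representation of G acting diagonally, where π ∘ θ is the representation g ↦ π(θ(g)). Then dim W ≤ 1, and W ≠ 0 if and only if π ∘ θ ≅ π*. Moreover, if W ≠ 0, the linear involution of (π ∘ θ) ⊗ π induced by v ⊗ w ↦ w ⊗ v (using that the underlying space of π ∘ θ equals that of π) preserves W and acts on W by the scalar ε_θ(π). -/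
open scoped Classical TensorProduct

noncomputable section

/-- The diagonal `G`-invariants `((π ∘ θ) ⊗ π)^{ΔG}` in the tensor square of the space of `π`. -/
def diagInvariants {G : Type} [Group G] {V : Type} [AddCommGroup V] [Module ℂ V]
    (θ : G ≃* G) (π : Representation ℂ G V) : Submodule ℂ (V ⊗[ℂ] V) :=
  Representation.invariants (Representation.tprod (MonoidHom.comp π θ.toMonoidHom) π)

namespace GK

open Module

section Contraction

variable {V : Type} [AddCommGroup V] [Module ℂ V] [FiniteDimensional ℂ V]

/-- Contraction of the first tensor factor, `v ⊗ w ↦ (f ↦ f v • w)`. -/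
def contractFst (V : Type) [AddCommGroup V] [Module ℂ V] [FiniteDimensional ℂ V] :
    V ⊗[ℂ] V ≃ₗ[ℂ] (Dual ℂ V →ₗ[ℂ] V) :=
  (TensorProduct.congr (evalEquiv ℂ V) (LinearEquiv.refl ℂ V)).trans
    (dualTensorHomEquiv ℂ (Dual ℂ V) V)

lemma contractFst_tmul (v w : V) (f : Dual ℂ V) :
    contractFst V (v ⊗ₜ[ℂ] w) f = f v • w := by
  simp [contractFst]

lemma contractFst_map (A B : V →ₗ[ℂ] V) (x : V ⊗[ℂ] V) (f : Dual ℂ V) :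
    contractFst V (TensorProduct.map A B x) f = B (contractFst V x (f ∘ₗ A)) := by
  induction x with
  | zero => simp
  | tmul v w => simp [contractFst_tmul]
  | add x y hx hy => simp [hx, hy]

lemma apply_contractFst_comm (x : V ⊗[ℂ] V) (f g : Dual ℂ V) :
    g (contractFst V (TensorProduct.comm ℂ V V x) f) = f (contractFst V x g) := by
  induction x with
  | zero => simp
  | tmul v w => simp [contractFst_tmul, mul_comm]
  | add x y hx hy => simp [hx, hy]

/-- If contraction with `x` inverts a bilinear form, then `x` and the form have the same
parity. -/
lemma comm_eq_smul_iff (x : V ⊗[ℂ] V) (e : V ≃ₗ[ℂ] Dual ℂ V)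
    (he : contractFst V x = e.symm.toLinearMap) (c : ℂ) :
    TensorProduct.comm ℂ V V x = c • x ↔ ∀ v w, e v w = c * e w v := by
  have hl (v w : V) : e w (contractFst V (TensorProduct.comm ℂ V V x) (e v)) = e v w := by
    rw [apply_contractFst_comm, he]
    simp
  have hr (v w : V) : e w (contractFst V (c • x) (e v)) = c * e w v := by
    simp [he]
  constructor
  · intro h v w
    rw [← hl, h, hr]
  · intro h
    apply (contractFst V).injective
    ext f
    obtain ⟨v, rfl⟩ := e.surjective f
    apply (evalEquiv ℂ V).injective
    ext g
    obtain ⟨w, rfl⟩ := e.surjective g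
    simpa only [evalEquiv_apply, Dual.eval_apply, hl, hr] using h v w

end Contraction

variable {G : Type} [Group G]
  {V : Type} [AddCommGroup V] [Module ℂ V]
  {θ : G ≃* G} {π : Representation ℂ G V}

lemma form_injective (hirr : IsIrred π) {B : V →ₗ[ℂ] V →ₗ[ℂ] ℂ} (hB : B ≠ 0)
    (hinv : ∀ (g : G) (v w : V), B (π g v) w = B v (π (θ g⁻¹) w)) :
    Function.Injective B := by
  rw [← LinearMap.ker_eq_bot]
  refine (hirr.2 (LinearMap.ker B) fun g v hv => ?_).resolve_right ?_
  · rw [LinearMap.mem_ker] at hv ⊢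
    ext w
    simp [hinv, hv]
  · rwa [LinearMap.ker_eq_top]

lemma conjThetaIsoDual_iff (hθ : ∀ g : G, θ (θ g) = g) :
    ConjThetaIsoDual θ π ↔
      ∃ e : V ≃ₗ[ℂ] Dual ℂ V, ∀ g v w, e (π g v) w = e v (π (θ g⁻¹) w) := by
  refine exists_congr fun e => ⟨fun h g v w => ?_, fun h g v => LinearMap.ext fun w => ?_⟩
  · have := LinearMap.congr_fun (h (θ g) v) w
    simpa [hθ, Representation.dual_apply, Dual.transpose_apply, -map_inv, ← map_inv θ] using this
  · have := h (θ g) v w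
    simpa [hθ, Representation.dual_apply, Dual.transpose_apply, -map_inv, ← map_inv θ] using this

variable [FiniteDimensional ℂ V]

lemma mem_diagInvariants_iff (x : V ⊗[ℂ] V) :
    x ∈ diagInvariants θ π ↔
      ∀ g f, π g (contractFst V x (f ∘ₗ π (θ g))) = contractFst V x f := by
  rw [diagInvariants, Representation.mem_invariants]
  refine forall_congr' fun g => ?_
  rw [← (contractFst V).injective.eq_iff, LinearMap.ext_iff]
  refine forall_congr' fun f => ?_
  rw [← contractFst_map]
  rfl

lemma comm_mem_diagInvariants (hθ : ∀ g : G, θ (θ g) = g) {x : V ⊗[ℂ] V}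
    (hx : x ∈ diagInvariants θ π) :
    TensorProduct.comm ℂ V V x ∈ diagInvariants θ π := by
  rw [mem_diagInvariants_iff] at hx ⊢
  intro g f
  apply (evalEquiv ℂ V).injective
  ext k
  have h := congrArg f (hx (θ g) k)
  rw [hθ] at h
  have h' := apply_contractFst_comm x (f ∘ₗ π (θ g)) (k ∘ₗ π g)
  simp only [LinearMap.comp_apply] at h'
  simp only [evalEquiv_apply, Dual.eval_apply]
  rw [h', h, apply_contractFst_comm]

lemma contractFst_bijective (hirr : IsIrred π) {x : V ⊗[ℂ] V}
    (hx : x ∈ diagInvariants θ π) (h0 : x ≠ 0) :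
    Function.Bijective (contractFst V x) := by
  rw [mem_diagInvariants_iff] at hx
  have hsurj : Function.Surjective (contractFst V x) := by
    rw [← LinearMap.range_eq_top]
    refine (hirr.2 (LinearMap.range (contractFst V x)) ?_).resolve_left ?_
    · rintro g _ ⟨f, rfl⟩
      refine ⟨f ∘ₗ π (θ g⁻¹), ?_⟩
      rw [← hx g, LinearMap.comp_assoc, ← Module.End.mul_eq_comp, ← map_mul, ← map_mul,
        inv_mul_cancel, map_one, map_one]
      rfl
    · rw [LinearMap.range_eq_bot]
      simpa using h0
  exact ⟨(LinearMap.injective_iff_surjective_of_finrank_eq_finrank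
    Subspace.dual_finrank_eq).2 hsurj, hsurj⟩

/-- The isomorphism `V ≃ V*` inverse to contraction with a nonzero diagonal invariant. -/
lemma exists_symm_eq_contractFst (hirr : IsIrred π) {x : V ⊗[ℂ] V}
    (hx : x ∈ diagInvariants θ π) (h0 : x ≠ 0) :
    ∃ e : V ≃ₗ[ℂ] Dual ℂ V, contractFst V x = e.symm.toLinearMap :=
  ⟨(LinearEquiv.ofBijective _ (contractFst_bijective hirr hx h0)).symm, rfl⟩

lemma mem_diagInvariants_iff_form (x : V ⊗[ℂ] V) (e : V ≃ₗ[ℂ] Dual ℂ V)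
    (he : contractFst V x = e.symm.toLinearMap) :
    x ∈ diagInvariants θ π ↔ ∀ g v w, e (π g v) w = e v (π (θ g⁻¹) w) := by
  rw [mem_diagInvariants_iff, he]
  constructor
  · intro h g v w
    have h' := h g (e v ∘ₗ π (θ g⁻¹))
    rw [LinearMap.comp_assoc, ← Module.End.mul_eq_comp, ← map_mul, ← map_mul,
      inv_mul_cancel, map_one, map_one] at h'
    have h1 : π g v = e.symm (e v ∘ₗ π (θ g⁻¹)) := by
      rw [← LinearEquiv.coe_coe, ← h']
      exact congrArg (π g) (e.symm_apply_apply v).symm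
    rw [h1, e.apply_symm_apply]
    rfl
  · intro h g f
    apply e.injective
    ext w
    simp [h, ← Module.End.mul_apply, ← map_mul, -map_inv]

lemma exists_eq_smul (hirr : IsIrred π) {x y : V ⊗[ℂ] V}
    (hx : x ∈ diagInvariants θ π) (h0 : x ≠ 0) (hy : y ∈ diagInvariants θ π) :
    ∃ c : ℂ, y = c • x := by
  have : Nontrivial V := by
    by_contra h
    rw [not_nontrivial_iff_subsingleton] at h
    exact hirr.1 (Subsingleton.elim _ _)
  obtain ⟨e, he⟩ := exists_symm_eq_contractFst hirr hx h0
  obtain ⟨c, hc⟩ := Module.End.exists_eigenvalue (contractFst V y ∘ₗ e.toLinearMap)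
  obtain ⟨v, hv⟩ := hc.exists_hasEigenvector
  refine ⟨c, ?_⟩
  by_contra hne
  have hinj := (contractFst_bijective hirr
    (Submodule.sub_mem _ hy (Submodule.smul_mem _ c hx)) (sub_ne_zero.2 hne)).1
  have hzero : contractFst V (y - c • x) (e v) = 0 := by
    have := hv.apply_eq_smul
    simp only [LinearMap.comp_apply, LinearEquiv.coe_coe] at this
    simp [he, this]
  exact hv.2 (e.map_eq_zero_iff.1 (hinj (hzero.trans (map_zero _).symm)))

/-- A nonzero invariant form of parity `c` gives a nonzero diagonal invariant of parity `c`. -/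
lemma exists_diagInvariant_of_form (hirr : IsIrred π) {B : V →ₗ[ℂ] V →ₗ[ℂ] ℂ} (hB : B ≠ 0)
    (hinv : ∀ (g : G) (v w : V), B (π g v) w = B v (π (θ g⁻¹) w))
    {c : ℂ} (hc : ∀ v w, B v w = c * B w v) :
    ∃ x ∈ diagInvariants θ π, x ≠ 0 ∧ TensorProduct.comm ℂ V V x = c • x := by
  have hinj := form_injective hirr hB hinv
  let e : V ≃ₗ[ℂ] Dual ℂ V := LinearEquiv.ofBijective B
    ⟨hinj, (LinearMap.injective_iff_surjective_of_finrank_eq_finrank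
      Subspace.dual_finrank_eq.symm).1 hinj⟩
  let x := (contractFst V).symm e.symm.toLinearMap
  have he : contractFst V x = e.symm.toLinearMap := (contractFst V).apply_symm_apply _
  refine ⟨x, (mem_diagInvariants_iff_form x e he).2 hinv, ?_, (comm_eq_smul_iff x e he c).2 hc⟩
  intro h0
  rw [h0, map_zero] at he
  refine hB (LinearMap.ext fun v => ?_)
  have hv : e.symm (e v) = 0 := (LinearMap.congr_fun he (e v)).symm
  rw [e.symm_apply_apply] at hv
  simp [hv]

/-- A nonzero diagonal invariant of parity `c` gives a nonzero invariant form of parity `c`. -/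
lemma exists_form_of_diagInvariant (hirr : IsIrred π) {x : V ⊗[ℂ] V}
    (hx : x ∈ diagInvariants θ π) (h0 : x ≠ 0) {c : ℂ}
    (hc : TensorProduct.comm ℂ V V x = c • x) :
    ∃ B : V →ₗ[ℂ] V →ₗ[ℂ] ℂ, B ≠ 0 ∧ (∀ v w, B v w = c * B w v) ∧
      ∀ (g : G) (v w : V), B (π g v) w = B v (π (θ g⁻¹) w) := by
  obtain ⟨e, he⟩ := exists_symm_eq_contractFst hirr hx h0
  refine ⟨e.toLinearMap, fun hz => hirr.1 ?_, (comm_eq_smul_iff x e he c).1 hc,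
    (mem_diagInvariants_iff_form x e he).1 hx⟩
  rw [← LinearEquiv.ker e, hz, LinearMap.ker_zero]

lemma eps_eq_of_comm_eq_smul (hirr : IsIrred π) {x : V ⊗[ℂ] V}
    (hx : x ∈ diagInvariants θ π) (h0 : x ≠ 0) {c : ℂ}
    (hc : TensorProduct.comm ℂ V V x = c • x) : (eps θ π : ℂ) = c := by
  have hsq : c * c = 1 := by
    have h := congrArg (TensorProduct.comm ℂ V V) hc
    rw [TensorProduct.comm_comm, map_smul, hc, smul_smul] at h
    exact (smul_left_injective ℂ h0 ((one_smul ℂ x).trans h)).symm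
  obtain ⟨B, hB, hsym, hinv⟩ := exists_form_of_diagInvariant hirr hx h0 hc
  rcases mul_self_eq_one_iff.1 hsq with rfl | rfl
  · have : HasSymForm θ π := ⟨B, hB, by simpa using hsym, hinv⟩
    simp [eps, this]
  · have halt : HasAltForm θ π := ⟨B, hB, by simpa using hsym, hinv⟩
    have hnot : ¬ HasSymForm θ π := by
      rintro ⟨B', hB', hsym', hinv'⟩
      obtain ⟨y, hy, hy0, hyc⟩ := exists_diagInvariant_of_form hirr hB' hinv' (c := 1)
        (by simpa using hsym')
      obtain ⟨d, rfl⟩ := exists_eq_smul hirr hx h0 hy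
      have : IsAddTorsionFree (V ⊗[ℂ] V) := .of_isTorsionFree ℂ _
      rw [map_smul, hc, one_smul, neg_one_smul, smul_neg] at hyc
      exact hy0 (neg_eq_self.1 hyc)
    simp [eps, halt, hnot]

lemma diagInvariants_ne_bot_iff (hθ : ∀ g : G, θ (θ g) = g) (hirr : IsIrred π) :
    diagInvariants θ π ≠ ⊥ ↔ ConjThetaIsoDual θ π := by
  rw [conjThetaIsoDual_iff hθ, Submodule.ne_bot_iff]
  constructor
  · rintro ⟨x, hx, h0⟩
    obtain ⟨e, he⟩ := exists_symm_eq_contractFst hirr hx h0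
    exact ⟨e, (mem_diagInvariants_iff_form x e he).1 hx⟩
  · rintro ⟨e, h⟩
    have he := (contractFst V).apply_symm_apply e.symm.toLinearMap
    refine ⟨_, (mem_diagInvariants_iff_form _ e he).2 h, fun h0 => hirr.1 ?_⟩
    rw [h0, map_zero] at he
    rw [← LinearEquiv.range e.symm, ← he, LinearMap.range_zero]

lemma finrank_diagInvariants_le_one (hirr : IsIrred π) :
    finrank ℂ (diagInvariants θ π) ≤ 1 := by
  by_cases h : diagInvariants θ π = ⊥
  · rw [h, finrank_bot]
    exact zero_le_one
  · obtain ⟨x, hx, h0⟩ := (Submodule.ne_bot_iff _).1 h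
    refine finrank_le_one ⟨x, hx⟩ fun ⟨y, hy⟩ => ?_
    obtain ⟨c, hc⟩ := exists_eq_smul hirr hx h0 hy
    exact ⟨c, Subtype.ext hc.symm⟩

end GK

/-- For irreducible `π`, the diagonal invariants `W = ((π∘θ) ⊗ π)^{ΔG}` satisfy
`dim W ≤ 1`; `W ≠ 0` iff `π ∘ θ ≅ π*`; and if `W ≠ 0` the flip `v ⊗ w ↦ w ⊗ v` preserves `W`
and acts on it by the scalar `ε_θ(π)`. -/
theorem diagInvariants_properties {G : Type} [Group G] [Fintype G]
    (θ : G ≃* G) (hθ : ∀ g : G, θ (θ g) = g)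
    {V : Type} [AddCommGroup V] [Module ℂ V] [FiniteDimensional ℂ V]
    (π : Representation ℂ G V) (hirr : GK.IsIrred π) :
    Module.finrank ℂ (diagInvariants θ π) ≤ 1 ∧
    (diagInvariants θ π ≠ ⊥ ↔ GK.ConjThetaIsoDual θ π) ∧
    (diagInvariants θ π ≠ ⊥ →
      ∀ x ∈ diagInvariants θ π,
        (TensorProduct.comm ℂ V V) x ∈ diagInvariants θ π ∧
        (TensorProduct.comm ℂ V V) x = (GK.eps θ π : ℂ) • x) := by
  refine ⟨GK.finrank_diagInvariants_le_one hirr, GK.diagInvariants_ne_bot_iff hθ hirr,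
    fun _ x hx => ⟨GK.comm_mem_diagInvariants hθ hx, ?_⟩⟩
  by_cases h0 : x = 0
  · simp [h0]
  · obtain ⟨c, hc⟩ := GK.exists_eq_smul hirr hx h0 (GK.comm_mem_diagInvariants hθ hx)
    rw [GK.eps_eq_of_comm_eq_smul hirr hx h0 hc, hc]
end
end
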